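/- There is an absolute constant C > 0 such that for every d ≥ 2, every n ∈ ℕ and every real polynomial P(x) = ∑_{α ∈ ℕ₀^n, |α| ≤ d} a_α x^α of degree at most d in n real variables, one has (∑_{|α| ≤ d} |a_α|^{2d/(d+1)})^{(d+1)/(2d)} ≤ C^{√(d·log d)} · d · (1+√2)^d · sup_{x ∈ [-1,1]^n} |P(x)|. -/

import Mathlib

open Finset

/-- The sup norm of a real polynomial in `n` variables over the cube `[-1,1]^n`. -/
noncomputable def supOnBox {n : ℕ} (P : MvPolynomial (Fin n) ℝ) : ℝ :=
  sSup {y : ℝ | ∃ x : Fin n → ℝ, (∀ i, x i ∈ Set.Icc (-1 : ℝ) 1) ∧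
    y = |MvPolynomial.eval x P|}

/-- A mixed-norm inequality of Blei type: the sum of `a ^ (2m/(m+1))` is controlled by the
`ℓ^{2k/(k+1)}(ℓ²)` norms of `a` along jointly injective projections. -/
lemma sum_rpow_le_prod_mixed {I J : Type*} {X : J → Type*} [Fintype I] [Fintype J]
    [∀ j, Fintype (X j)] [∀ j, DecidableEq (X j)] (π : ∀ j, I → X j)
    (hπ : ∀ i i', (∀ j, π j i = π j i') → i = i') (k : J → ℕ) (m : ℕ) (hm : ∑ j, k j = m)
    (hm0 : 0 < m)
    (a : I → ℝ) (ha : ∀ i, 0 ≤ a i) :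
    (∑ i, a i ^ ((2 * m : ℝ) / (m + 1))) ^ (m + 1) ≤
      ∏ j, (∑ u, (∑ i with π j i = u, a i ^ 2) ^ ((k j : ℝ) / (k j + 1))) ^ (k j + 1) := by
  classical
  set B : ∀ j, X j → ℝ := fun j u => ∑ i with π j i = u, a i ^ 2 with hB
  set N : J → ℝ := fun j => ∑ u, (B j u) ^ ((k j : ℝ) / (k j + 1)) with hN
  have hB0 : ∀ j u, 0 ≤ B j u := fun j u => sum_nonneg fun i _ => sq_nonneg _
  have hm1 : (0 : ℝ) < m + 1 := by positivity
  have hm0' : (0 : ℝ) < m := by exact_mod_cast hm0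
  have hp : (0 : ℝ) < (2 * m : ℝ) / (m + 1) := by positivity
  have hk1 : ∀ j, (0 : ℝ) < k j + 1 := fun j => by positivity
  have hN0 : ∀ j, 0 ≤ N j := fun j => sum_nonneg fun u _ => Real.rpow_nonneg (hB0 j u) _
  have hBpos : ∀ i, 0 < a i → ∀ j, 0 < B j (π j i) := fun i hi j =>
    lt_of_lt_of_le (pow_pos hi 2)
      (single_le_sum (f := fun i => a i ^ 2) (fun i _ => sq_nonneg _) (by simp))
  by_cases hz : ∀ i, a i = 0
  · rw [sum_eq_zero fun i _ => by rw [hz i, Real.zero_rpow hp.ne'], zero_pow (by omega)]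
    exact prod_nonneg fun j _ => pow_nonneg (hN0 j) _
  push Not at hz
  obtain ⟨i₀, hi₀⟩ := hz
  have hi₀ : 0 < a i₀ := lt_of_le_of_ne (ha _) (Ne.symm hi₀)
  have hNpos : ∀ j, 0 < N j := fun j =>
    lt_of_lt_of_le (Real.rpow_pos_of_pos (hBpos i₀ hi₀ j) _)
      (single_le_sum (f := fun u => (B j u) ^ ((k j : ℝ) / (k j + 1)))
        (fun u _ => Real.rpow_nonneg (hB0 j u) _) (mem_univ _))
  set R : ℝ := ∏ j, N j ^ (((k j : ℝ) + 1) / (m + 1)) with hR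
  have hRpos : 0 < R := prod_pos fun j _ => Real.rpow_pos_of_pos (hNpos j) _
  have hsumk : ∑ j, (k j : ℝ) = m := by exact_mod_cast hm
  -- pointwise bound by the weighted AM-GM inequality
  have key : ∀ i, a i ^ ((2 * m : ℝ) / (m + 1)) ≤
      R * ((1 / (m + 1)) * (∏ j, (B j (π j i) ^ ((k j : ℝ) / (k j + 1)) / N j)) +
        ∑ j, ((k j : ℝ) / (m + 1)) *
          (a i ^ 2 * B j (π j i) ^ (-(1 : ℝ) / (k j + 1)) / N j)) := by
    intro i
    rcases (ha i).eq_or_lt with h0 | hi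
    · rw [← h0, Real.zero_rpow hp.ne']
      refine mul_nonneg hRpos.le (add_nonneg (mul_nonneg (by positivity) (prod_nonneg fun j _ => ?_))
        (sum_nonneg fun j _ => ?_))
      · exact div_nonneg (Real.rpow_nonneg (hB0 _ _) _) (hN0 j)
      · simp
    have hb := hBpos i hi
    have := Real.geom_mean_le_arith_mean_weighted (univ : Finset (Option J))
      (fun o => o.elim (1 / ((m : ℝ) + 1)) fun j => (k j : ℝ) / (m + 1))
      (fun o => o.elim (∏ j, (B j (π j i) ^ ((k j : ℝ) / (k j + 1)) / N j))
        fun j => (a i ^ 2 * B j (π j i) ^ (-(1 : ℝ) / (k j + 1)) / N j)) ?_ ?_ ?_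
    · rw [Fintype.sum_option, Fintype.prod_option] at this
      simp only [Option.elim] at this
      rw [← div_le_iff₀' hRpos]
      refine le_trans (le_of_eq ?_) this
      rw [← Real.finsetProd_rpow _ _ (fun j _ => div_nonneg (Real.rpow_nonneg (hB0 _ _) _) (hN0 j)),
        ← prod_mul_distrib, hR]
      have e1 : a i ^ ((2 * m : ℝ) / (m + 1)) = ∏ j, a i ^ ((2 * k j : ℝ) / (m + 1)) := by
        rw [← Real.rpow_sum_of_pos hi, ← sum_div, ← mul_sum, hsumk]
      rw [e1, ← prod_div_distrib]
      refine prod_congr rfl fun j _ => ?_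
      have hbj := hb j
      have hnj := hNpos j
      rw [Real.div_rpow (by positivity) (by positivity), Real.div_rpow (by positivity) (by positivity),
        Real.mul_rpow (by positivity) (by positivity), ← Real.rpow_mul hbj.le, ← Real.rpow_mul hbj.le,
        ← Real.rpow_natCast, ← Real.rpow_mul hi.le, add_div, Real.rpow_add hnj]
      have e2 : B j (π j i) ^ ((k j : ℝ) / (k j + 1) * (1 / (m + 1))) *
          B j (π j i) ^ (-(1 : ℝ) / (k j + 1) * (k j / (m + 1))) = 1 := by
        rw [← Real.rpow_add hbj]
        convert Real.rpow_zero _ using 2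
        have := (hk1 j).ne'
        field_simp
        ring
      have e3 : ((2 : ℕ) : ℝ) * (k j / (m + 1)) = 2 * k j / (m + 1) := by push_cast; ring
      rw [e3, div_mul_div_comm, mul_comm (N j ^ (1 / ((m : ℝ) + 1)))]
      congr 1
      rw [mul_left_comm, e2, mul_one]
    · rintro (_ | j) _ <;> simp only [Option.elim] <;> positivity
    · rw [Fintype.sum_option]
      simp only [Option.elim]
      rw [← sum_div, hsumk, ← add_div, add_comm, div_self hm1.ne']
    · rintro (_ | j) _ <;> simp only [Option.elim]
      · exact prod_nonneg fun j _ => div_nonneg (Real.rpow_nonneg (hB0 _ _) _) (hN0 j)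
      · have := hb j
        have := hNpos j
        positivity
  have s1 : ∑ i, ∏ j, (B j (π j i) ^ ((k j : ℝ) / (k j + 1)) / N j) ≤ 1 := by
    have hinj : Function.Injective (fun i => fun j => π j i) := fun i i' h =>
      hπ i i' fun j => congrFun h j
    calc ∑ i, ∏ j, (B j (π j i) ^ ((k j : ℝ) / (k j + 1)) / N j)
        = ∑ x ∈ univ.image (fun i => fun j => π j i),
            ∏ j, (B j (x j) ^ ((k j : ℝ) / (k j + 1)) / N j) := by
          rw [sum_image hinj.injOn]
      _ ≤ ∑ x : ∀ j, X j, ∏ j, (B j (x j) ^ ((k j : ℝ) / (k j + 1)) / N j) :=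
          sum_le_sum_of_subset_of_nonneg (subset_univ _) fun x _ _ =>
            prod_nonneg fun j _ => div_nonneg (Real.rpow_nonneg (hB0 _ _) _) (hN0 j)
      _ = ∏ j, ∑ u, (B j u ^ ((k j : ℝ) / (k j + 1)) / N j) := by
          rw [Fintype.prod_sum]
      _ = 1 := prod_eq_one fun j _ => by rw [← sum_div, div_self (hNpos j).ne']
  have s2 : ∀ j, ∑ i, (a i ^ 2 * B j (π j i) ^ (-(1 : ℝ) / (k j + 1)) / N j) ≤ 1 := by
    intro j
    rw [← sum_div, div_le_one (hNpos j), ← sum_fiberwise univ (π j)]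
    refine sum_le_sum fun u _ => ?_
    have : ∑ i with π j i = u, a i ^ 2 * B j (π j i) ^ (-(1 : ℝ) / (k j + 1)) =
        B j u * B j u ^ (-(1 : ℝ) / (k j + 1)) := by
      rw [hB, sum_mul]
      refine sum_congr rfl fun i hi => ?_
      rw [(mem_filter.1 hi).2]
    rw [this]
    rcases (hB0 j u).eq_or_lt with h | h
    · rw [← h, zero_mul]
      exact Real.rpow_nonneg le_rfl _
    · refine le_of_eq ?_
      nth_rw 1 [← Real.rpow_one (B j u)]
      rw [← Real.rpow_add h]
      congr 1
      have := (hk1 j).ne'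
      field_simp
      ring
  have main : ∑ i, a i ^ ((2 * m : ℝ) / (m + 1)) ≤ R := by
    refine (sum_le_sum fun i _ => key i).trans ?_
    rw [← mul_sum]
    refine mul_le_of_le_one_right hRpos.le ?_
    rw [sum_add_distrib, ← mul_sum, sum_comm]
    simp_rw [← mul_sum]
    calc _ ≤ 1 / ((m : ℝ) + 1) * 1 + ∑ j, (k j : ℝ) / (m + 1) * 1 := by
          refine add_le_add (mul_le_mul_of_nonneg_left s1 (by positivity))
            (sum_le_sum fun j _ => mul_le_mul_of_nonneg_left (s2 j) (by positivity))
      _ = 1 := by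
          simp only [mul_one]
          rw [← sum_div, hsumk, ← add_div, add_comm, div_self hm1.ne']
  calc _ ≤ R ^ (m + 1) := pow_le_pow_left₀ (sum_nonneg fun i _ => Real.rpow_nonneg (ha i) _) main _
    _ = _ := by
      rw [hR, ← prod_pow]
      refine prod_congr rfl fun j _ => ?_
      rw [← Real.rpow_natCast, ← Real.rpow_mul (hN0 j), ← Real.rpow_natCast]
      congr 1
      push_cast
      field_simp

lemma sum_nthRootsFinset_pow_mul_conj_pow {N : ℕ} (hN : 0 < N) {a b : ℕ} (ha : a < N)
    (hb : b < N) :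
    ∑ z ∈ Polynomial.nthRootsFinset N (1 : ℂ), z ^ a * (starRingEnd ℂ) (z ^ b) =
      if a = b then ((#(Polynomial.nthRootsFinset N (1 : ℂ)) : ℕ) : ℂ) else 0 := by
  have hnorm : ∀ z ∈ Polynomial.nthRootsFinset N (1 : ℂ), ‖z‖ = 1 := fun z hz =>
    Complex.norm_eq_one_of_pow_eq_one ((Polynomial.mem_nthRootsFinset hN 1).1 hz) hN.ne'
  have hconj : ∀ z : ℂ, ‖z‖ = 1 → z * (starRingEnd ℂ) z = 1 := fun z hz => by
    rw [Complex.mul_conj, Complex.normSq_eq_norm_sq, hz]; simp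
  split_ifs with h
  · subst h
    rw [card_eq_sum_ones, Nat.cast_sum]
    refine sum_congr rfl fun z hz => ?_
    rw [hconj _ (by rw [norm_pow, hnorm z hz, one_pow]), Nat.cast_one]
  · obtain ⟨ω, hω⟩ : ∃ ω : ℂ, IsPrimitiveRoot ω N := ⟨_, Complex.isPrimitiveRoot_exp N hN.ne'⟩
    have hω1 : ‖ω‖ = 1 := Complex.norm_eq_one_of_pow_eq_one hω.pow_eq_one hN.ne'
    have hω0 : ω ≠ 0 := hω.ne_zero hN.ne'
    set S := ∑ z ∈ Polynomial.nthRootsFinset N (1 : ℂ), z ^ a * (starRingEnd ℂ) (z ^ b) with hS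
    have hshift : S = (ω ^ a * (starRingEnd ℂ) (ω ^ b)) * S := by
      rw [hS, mul_sum]
      symm
      refine sum_bij (fun z _ => ω * z) ?_ ?_ ?_ ?_
      · intro z hz
        rw [Polynomial.mem_nthRootsFinset hN] at hz ⊢
        rw [mul_pow, hω.pow_eq_one, hz, one_mul]
      · intro z _ w _ h
        exact mul_left_cancel₀ hω0 h
      · intro z hz
        refine ⟨ω⁻¹ * z, ?_, by field_simp⟩
        rw [Polynomial.mem_nthRootsFinset hN] at hz ⊢
        rw [mul_pow, inv_pow, hω.pow_eq_one, hz, inv_one, one_mul]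
      · intro z _
        rw [mul_pow, mul_pow, map_mul]
        ring
    by_contra hS0
    have h1 : ω ^ a * (starRingEnd ℂ) (ω ^ b) = 1 := by
      refine mul_right_cancel₀ hS0 ?_
      rw [one_mul, ← hshift]
    have h2 : ω ^ a = ω ^ b := by
      calc ω ^ a = ω ^ a * (ω ^ b * (starRingEnd ℂ) (ω ^ b)) := by
            rw [hconj _ (by rw [norm_pow, hω1, one_pow]), mul_one]
        _ = ω ^ b * (ω ^ a * (starRingEnd ℂ) (ω ^ b)) := by ring
        _ = ω ^ b := by rw [h1, mul_one]
    exact h (hω.pow_inj ha hb h2)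

/-- On the finite set `Y` of points, all monomials with exponents at most `D` are orthogonal. -/
def MonomialsOrthogonal {κ : Type*} [Fintype κ] (D : ℕ) (Y : Finset (κ → ℂ)) : Prop :=
  ∀ α β : κ → ℕ, (∀ a, α a ≤ D) → (∀ a, β a ≤ D) →
    ∑ y ∈ Y, (∏ a, y a ^ α a) * (starRingEnd ℂ) (∏ a, y a ^ β a) =
      if α = β then ((#Y : ℕ) : ℂ) else 0

/-- A finite subset of the torus on which monomials of bounded degree are orthogonal. -/
lemma exists_orthogonal_torus_finset (κ : Type*) [Fintype κ] (D : ℕ) :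
    ∃ Y : Finset (κ → ℂ), Y.Nonempty ∧ (∀ y ∈ Y, ∀ a, ‖y a‖ = 1) ∧
      MonomialsOrthogonal D Y := by
  classical
  have hN : 0 < D + 1 := by omega
  refine ⟨Fintype.piFinset fun _ => Polynomial.nthRootsFinset (D + 1) (1 : ℂ), ?_, ?_, ?_⟩
  · exact ⟨fun _ => 1, Fintype.mem_piFinset.2 fun _ => by
      rw [Polynomial.mem_nthRootsFinset hN, one_pow]⟩
  · intro y hy a
    exact Complex.norm_eq_one_of_pow_eq_one
      ((Polynomial.mem_nthRootsFinset hN 1).1 (Fintype.mem_piFinset.1 hy a)) hN.ne'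
  · intro α β hα hβ
    simp_rw [map_prod, ← prod_mul_distrib]
    rw [← prod_univ_sum (fun _ : κ => Polynomial.nthRootsFinset (D + 1) (1 : ℂ))
      (fun a z => z ^ α a * (starRingEnd ℂ) (z ^ β a))]
    simp_rw [fun a => sum_nthRootsFinset_pow_mul_conj_pow hN (Nat.lt_succ_of_le (hα a))
      (Nat.lt_succ_of_le (hβ a))]
    split_ifs with h
    · subst h
      simp [Fintype.card_piFinset]
    · obtain ⟨a, ha⟩ := Function.ne_iff.1 h
      exact prod_eq_zero (mem_univ a) (if_neg ha)

lemma sum_norm_sq_eq {κ : Type*} [Fintype κ] {D : ℕ} {Y : Finset (κ → ℂ)}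
    (hY : MonomialsOrthogonal D Y) (s : Finset (κ → ℕ)) (hs : ∀ α ∈ s, ∀ a, α a ≤ D) (A : (κ → ℕ) → ℂ) :
    ∑ y ∈ Y, ‖∑ α ∈ s, A α * ∏ a, y a ^ α a‖ ^ 2 = #Y * ∑ α ∈ s, ‖A α‖ ^ 2 := by
  have h : ((∑ y ∈ Y, ‖∑ α ∈ s, A α * ∏ a, y a ^ α a‖ ^ 2 : ℝ) : ℂ) =
      ((#Y * ∑ α ∈ s, ‖A α‖ ^ 2 : ℝ) : ℂ) := by
    push_cast
    simp_rw [← Complex.mul_conj', map_sum, sum_mul_sum, map_mul]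
    rw [sum_comm]
    rw [mul_sum]
    refine sum_congr rfl fun α hα => ?_
    rw [sum_comm, sum_eq_single_of_mem α hα]
    · have := hY α α (hs α hα) (hs α hα)
      rw [if_pos rfl] at this
      rw [← this, sum_mul]
      exact sum_congr rfl fun y _ => by ring
    · intro β hβ hne
      have := hY α β (hs α hα) (hs β hβ)
      rw [if_neg hne.symm] at this
      calc _ = ∑ y ∈ Y, (A α * (starRingEnd ℂ) (A β)) *
            ((∏ a, y a ^ α a) * (starRingEnd ℂ) (∏ a, y a ^ β a)) :=
            sum_congr rfl fun y _ => by ring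
        _ = 0 := by rw [← mul_sum, this, mul_zero]
  exact_mod_cast h

lemma sum_norm_pow_four_le {κ : Type*} [Fintype κ] {D : ℕ} {Y : Finset (κ → ℂ)}
    (hY : MonomialsOrthogonal D Y) (s : Finset (κ → ℕ)) {m : ℕ} (hm : 2 * m ≤ D)
    (hs : ∀ α ∈ s, ∑ a, α a ≤ m) (A : (κ → ℕ) → ℂ) :
    ∑ y ∈ Y, ‖∑ α ∈ s, A α * ∏ a, y a ^ α a‖ ^ 4 ≤
      #Y * 4 ^ m * (∑ α ∈ s, ‖A α‖ ^ 2) ^ 2 := by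
  classical
  set q : Finset ((κ → ℕ) × (κ → ℕ)) := s ×ˢ s with hq
  set g : (κ → ℕ) × (κ → ℕ) → (κ → ℕ) := fun x => x.1 + x.2 with hg
  set B : (κ → ℕ) → ℂ := fun γ => ∑ x ∈ q with g x = γ, A x.1 * A x.2 with hB
  have hdeg : ∀ x ∈ q, ∑ a, g x a ≤ 2 * m := by
    intro x hx
    rw [hq, mem_product] at hx
    have h1 := hs _ hx.1
    have h2 := hs _ hx.2
    simp only [hg, Pi.add_apply, sum_add_distrib]
    omega
  have hsq : ∀ y : κ → ℂ, (∑ α ∈ s, A α * ∏ a, y a ^ α a) ^ 2 =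
      ∑ γ ∈ q.image g, B γ * ∏ a, y a ^ γ a := by
    intro y
    rw [sq, sum_mul_sum, ← sum_product', ← sum_fiberwise_of_maps_to
      (g := g) (t := q.image g) (fun x hx => mem_image_of_mem _ hx)]
    refine sum_congr rfl fun γ _ => ?_
    rw [hB, sum_mul]
    refine sum_congr rfl fun x hx => ?_
    rw [← (mem_filter.1 hx).2]
    simp only [hg, Pi.add_apply, pow_add, prod_mul_distrib]
    ring
  have h1 : ∑ y ∈ Y, ‖∑ α ∈ s, A α * ∏ a, y a ^ α a‖ ^ 4 =
      #Y * ∑ γ ∈ q.image g, ‖B γ‖ ^ 2 := by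
    rw [← sum_norm_sq_eq hY (q.image g) ?_ B]
    · refine sum_congr rfl fun y _ => ?_
      rw [← hsq, norm_pow, ← pow_mul]
    · intro γ hγ a
      obtain ⟨x, hx, rfl⟩ := mem_image.1 hγ
      exact (single_le_sum (fun _ _ => Nat.zero_le _) (mem_univ a)).trans ((hdeg x hx).trans hm)
  rw [h1, mul_assoc]
  refine mul_le_mul_of_nonneg_left ?_ (by positivity)
  have hcard : ∀ γ ∈ q.image g, (#{x ∈ q | g x = γ} : ℝ) ≤ 4 ^ m := by
    intro γ hγ
    obtain ⟨x₀, hx₀, hx₀γ⟩ := mem_image.1 hγ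
    have hsum : ∑ a, γ a ≤ 2 * m := hx₀γ ▸ hdeg x₀ hx₀
    have : #{x ∈ q | g x = γ} ≤ #(Fintype.piFinset fun a => range (γ a + 1)) := by
      refine card_le_card_of_injOn Prod.fst ?_ ?_
      · intro x hx
        have hx := (mem_filter.1 hx).2
        refine Fintype.mem_piFinset.2 fun a => mem_range.2 ?_
        rw [← hx]
        simp only [hg, Pi.add_apply]
        omega
      · intro x hx x' hx' h
        have e1 := (mem_filter.1 hx).2
        have e2 := (mem_filter.1 hx').2
        simp only [hg] at e1 e2
        refine Prod.ext h ?_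
        rw [h] at e1
        exact add_left_cancel (e1.trans e2.symm)
    have h2 : #(Fintype.piFinset fun a => range (γ a + 1)) ≤ 4 ^ m := by
      rw [Fintype.card_piFinset]
      calc ∏ a, #(range (γ a + 1)) ≤ ∏ a, 2 ^ γ a := prod_le_prod' fun a _ => by
            rw [card_range]; exact Nat.lt_two_pow_self
        _ = 2 ^ ∑ a, γ a := prod_pow_eq_pow_sum _ _ _
        _ ≤ 2 ^ (2 * m) := Nat.pow_le_pow_right (by norm_num) hsum
        _ = 4 ^ m := by rw [pow_mul]; norm_num
    exact_mod_cast this.trans h2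
  calc ∑ γ ∈ q.image g, ‖B γ‖ ^ 2
      ≤ ∑ γ ∈ q.image g, 4 ^ m * ∑ x ∈ q with g x = γ, ‖A x.1‖ ^ 2 * ‖A x.2‖ ^ 2 := by
        refine sum_le_sum fun γ hγ => ?_
        calc ‖B γ‖ ^ 2 ≤ (∑ x ∈ q with g x = γ, ‖A x.1 * A x.2‖) ^ 2 :=
              pow_le_pow_left₀ (norm_nonneg _) (norm_sum_le _ _) 2
          _ ≤ #{x ∈ q | g x = γ} * ∑ x ∈ q with g x = γ, ‖A x.1 * A x.2‖ ^ 2 :=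
              sq_sum_le_card_mul_sum_sq
          _ ≤ 4 ^ m * ∑ x ∈ q with g x = γ, ‖A x.1 * A x.2‖ ^ 2 :=
              mul_le_mul_of_nonneg_right (hcard γ hγ) (sum_nonneg fun _ _ => sq_nonneg _)
          _ = _ := by simp_rw [norm_mul, mul_pow]
    _ = 4 ^ m * ∑ x ∈ q, ‖A x.1‖ ^ 2 * ‖A x.2‖ ^ 2 := by
        rw [← mul_sum, sum_fiberwise_of_maps_to (fun x hx => mem_image_of_mem _ hx)]
    _ = _ := by rw [hq, sum_product, sq, sum_mul_sum]

/-- Hypercontractivity between `L^{2k/(k+1)}` and `L²` for polynomials of degree `m` on the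
torus. -/
lemma sum_norm_sq_rpow_le {κ : Type*} [Fintype κ] {D : ℕ} {Y : Finset (κ → ℂ)}
    (hY : MonomialsOrthogonal D Y) (hY0 : Y.Nonempty) (s : Finset (κ → ℕ)) {m : ℕ} (hm : 2 * m ≤ D)
    (hs : ∀ α ∈ s, ∑ a, α a ≤ m) (A : (κ → ℕ) → ℂ) {k : ℕ} (hk : 0 < k) :
    (∑ α ∈ s, ‖A α‖ ^ 2) ^ ((k : ℝ) / (k + 1)) ≤ (4 : ℝ) ^ ((m : ℝ) / (k + 1)) *
      ((∑ y ∈ Y, ‖∑ α ∈ s, A α * ∏ a, y a ^ α a‖ ^ ((2 * k : ℝ) / (k + 1))) / #Y) := by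
  set W := ∑ α ∈ s, ‖A α‖ ^ 2 with hW
  set F : (κ → ℂ) → ℝ := fun y => ‖∑ α ∈ s, A α * ∏ a, y a ^ α a‖ with hF
  set S := ∑ y ∈ Y, F y ^ ((2 * k : ℝ) / (k + 1)) with hS
  have hF0 : ∀ y, 0 ≤ F y := fun y => norm_nonneg _
  have hS0 : 0 ≤ S := sum_nonneg fun y _ => Real.rpow_nonneg (hF0 y) _
  have hc : (0 : ℝ) < #Y := by exact_mod_cast hY0.card_pos
  have hk' : (0 : ℝ) < k := by exact_mod_cast hk
  have hk1 : (0 : ℝ) < k + 1 := by positivity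
  have hk2 : (0 : ℝ) < k + 2 := by positivity
  have hW0 : 0 ≤ W := sum_nonneg fun _ _ => sq_nonneg _
  have hsD : ∀ α ∈ s, ∀ a, α a ≤ D := fun α hα a =>
    (single_le_sum (fun _ _ => Nat.zero_le _) (mem_univ a)).trans ((hs α hα).trans (by omega))
  have h2 : ∑ y ∈ Y, F y ^ 2 = #Y * W := sum_norm_sq_eq hY s hsD A
  have h4 : ∑ y ∈ Y, F y ^ 4 ≤ #Y * 4 ^ m * W ^ 2 := sum_norm_pow_four_le hY s hm hs A
  have h40 : 0 ≤ ∑ y ∈ Y, F y ^ 4 := sum_nonneg fun y _ => pow_nonneg (hF0 y) 4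
  have holder : #Y * W ≤ S ^ (((k : ℝ) + 1) / (k + 2)) * (∑ y ∈ Y, F y ^ 4) ^ (1 / ((k : ℝ) + 2)) := by
    have hpq : Real.HolderConjugate (((k : ℝ) + 2) / (k + 1)) (k + 2) := by
      rw [Real.holderConjugate_iff]
      refine ⟨by rw [lt_div_iff₀ hk1]; linarith, ?_⟩
      field_simp
      ring
    have := Real.inner_le_Lp_mul_Lq_of_nonneg Y hpq (f := fun y => F y ^ ((2 * k : ℝ) / (k + 2)))
      (g := fun y => F y ^ ((4 : ℝ) / (k + 2))) (fun y _ => Real.rpow_nonneg (hF0 y) _)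
      (fun y _ => Real.rpow_nonneg (hF0 y) _)
    rw [← h2]
    refine le_trans (le_of_eq ?_) (this.trans (le_of_eq ?_))
    · refine sum_congr rfl fun y _ => ?_
      rw [← Real.rpow_add_of_nonneg (hF0 y) (by positivity) (by positivity), ← Real.rpow_natCast]
      congr 1
      push_cast
      field_simp
      ring
    · congr 2
      · refine sum_congr rfl fun y _ => ?_
        rw [← Real.rpow_mul (hF0 y)]
        congr 1
        field_simp
      · field_simp
      · refine sum_congr rfl fun y _ => ?_
        rw [← Real.rpow_mul (hF0 y), ← Real.rpow_natCast]
        congr 1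
        push_cast
        field_simp
  have hpow : (#Y * W) ^ (k + 2) ≤ S ^ (k + 1) * (#Y * 4 ^ m * W ^ 2) := by
    calc (#Y * W) ^ (k + 2) ≤ _ := pow_le_pow_left₀ (by positivity) holder _
      _ = S ^ (k + 1) * ∑ y ∈ Y, F y ^ 4 := by
        rw [mul_pow, ← Real.rpow_natCast, ← Real.rpow_natCast, ← Real.rpow_mul hS0,
          ← Real.rpow_mul h40, ← Real.rpow_natCast S]
        congr 1
        · congr 1
          push_cast
          field_simp
        · push_cast
          rw [one_div_mul_cancel hk2.ne', Real.rpow_one]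
      _ ≤ _ := mul_le_mul_of_nonneg_left h4 (by positivity)
  have hfin : W ^ k ≤ 4 ^ m * (S / #Y) ^ (k + 1) := by
    rcases hW0.eq_or_lt with h | h
    · rw [← h, zero_pow hk.ne']
      positivity
    · rw [div_pow, ← mul_div_assoc, le_div_iff₀ (by positivity)]
      refine le_of_mul_le_mul_right ?_ (by positivity : 0 < (#Y : ℝ) * W ^ 2)
      calc _ = (#Y * W) ^ (k + 2) := by ring
        _ ≤ _ := hpow
        _ = _ := by ring
  calc W ^ ((k : ℝ) / (k + 1)) = (W ^ k) ^ (1 / ((k : ℝ) + 1)) := by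
        rw [← Real.rpow_natCast, ← Real.rpow_mul hW0, mul_one_div]
    _ ≤ (4 ^ m * (S / #Y) ^ (k + 1)) ^ (1 / ((k : ℝ) + 1)) :=
        Real.rpow_le_rpow (by positivity) hfin (by positivity)
    _ = _ := by
        rw [Real.mul_rpow (by positivity) (by positivity), ← Real.rpow_natCast, ← Real.rpow_natCast,
          ← Real.rpow_mul (by norm_num), ← Real.rpow_mul (by positivity), mul_one_div]
        congr 1
        push_cast
        rw [mul_one_div_cancel hk1.ne', Real.rpow_one]

lemma sum_fiber_norm_sq_rpow_le {κ : Type*} [Fintype κ] [DecidableEq κ] {D : ℕ}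
    {Y : Finset (κ → ℂ)} (hY : MonomialsOrthogonal D Y) (hY0 : Y.Nonempty) {V : Type*}
    (s : Finset V) (φ : V → κ → ℕ) {m : ℕ} (hm : 2 * m ≤ D) (hs : ∀ v ∈ s, ∑ a, φ v a ≤ m)
    (c : V → ℂ) {k : ℕ} (hk : 0 < k) :
    (∑ α ∈ s.image φ, ‖∑ v ∈ s with φ v = α, c v‖ ^ 2) ^ ((k : ℝ) / (k + 1)) ≤
      (4 : ℝ) ^ ((m : ℝ) / (k + 1)) *
      ((∑ y ∈ Y, ‖∑ v ∈ s, c v * ∏ a, y a ^ φ v a‖ ^ ((2 * k : ℝ) / (k + 1))) / #Y) := by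
  have h := sum_norm_sq_rpow_le hY hY0 (s.image φ) hm
    (fun α hα => by obtain ⟨v, hv, rfl⟩ := mem_image.1 hα; exact hs v hv)
    (fun α => ∑ v ∈ s with φ v = α, c v) hk
  have e : ∀ y : κ → ℂ, ∑ v ∈ s, c v * ∏ a, y a ^ φ v a =
      ∑ α ∈ s.image φ, (∑ v ∈ s with φ v = α, c v) * ∏ a, y a ^ α a := by
    intro y
    rw [← sum_fiberwise_of_maps_to (g := φ) (t := s.image φ) (fun v hv => mem_image_of_mem _ hv)]
    refine sum_congr rfl fun α _ => ?_
    rw [sum_mul]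
    exact sum_congr rfl fun v hv => by rw [(mem_filter.1 hv).2]
  simp_rw [e]
  exact h

/-- A Bohnenblust–Hille inequality for multilinear forms. -/
lemma multilinear_bohnenblust_hille {σ ι : Type*} [Fintype σ] [Fintype ι] [DecidableEq σ]
    [DecidableEq ι] {k : ℕ} (hk : Fintype.card σ = k) (hk0 : 0 < k) (q : (σ → ι) → ℂ) {M : ℝ}
    (hM : ∀ x : σ → ι → ℂ, (∀ s a, ‖x s a‖ ≤ 1) → ‖∑ u, q u * ∏ s, x s (u s)‖ ≤ M) :
    (∑ u, ‖q u‖ ^ ((2 * k : ℝ) / (k + 1))) ^ (k + 1) ≤ (2 ^ k * M) ^ (2 * k) := by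
  have hb := sum_rpow_le_prod_mixed (X := fun _ : σ => ι) (fun s (u : σ → ι) => u s)
    (fun i i' h => funext h) (fun _ => 1) k (by simp [hk]) hk0 (fun u => ‖q u‖)
    (fun u => norm_nonneg _)
  refine hb.trans ?_
  have hM0 : 0 ≤ M := (norm_nonneg _).trans (hM 0 (by simp))
  suffices H : ∀ s : σ, ∑ a, (∑ u : σ → ι with u s = a, ‖q u‖ ^ 2) ^
      (((1 : ℕ) : ℝ) / ((1 : ℕ) + 1)) ≤ 2 ^ k * M by
    calc _ ≤ ∏ _s : σ, (2 ^ k * M) ^ (1 + 1) := prod_le_prod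
          (fun s _ => pow_nonneg (sum_nonneg fun a _ => Real.rpow_nonneg
            (sum_nonneg fun _ _ => sq_nonneg _) _) _)
          (fun s _ => pow_le_pow_left₀ (sum_nonneg fun a _ => Real.rpow_nonneg
            (sum_nonneg fun _ _ => sq_nonneg _) _) (H s) _)
      _ = _ := by rw [prod_const, card_univ, hk, ← pow_mul]
  intro s
  obtain ⟨Y, hY0, hY1, hY⟩ := exists_orthogonal_torus_finset (σ × ι) (2 * k)
  have hc : (0 : ℝ) < #Y := by exact_mod_cast hY0.card_pos
  set φ : (σ → ι) → σ × ι → ℕ := fun u p => if u p.1 = p.2 then 1 else 0 with hφ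
  have hφinj : Function.Injective φ := by
    intro u u' h
    funext t
    have := congrFun h (t, u t)
    simp only [hφ, if_true] at this
    by_contra hne
    rw [if_neg (Ne.symm hne)] at this
    exact one_ne_zero this
  have hdeg : ∀ u, ∑ p, φ u p = k := by
    intro u
    rw [Fintype.sum_prod_type]
    simp [hφ, hk]
  have hmon : ∀ (u : σ → ι) (y : σ × ι → ℂ), ∏ p, y p ^ φ u p = ∏ t, y (t, u t) := by
    intro u y
    rw [Fintype.prod_prod_type]
    refine prod_congr rfl fun t _ => ?_
    rw [prod_eq_single (u t)]
    · simp [hφ]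
    · intro b _ hb
      simp [hφ, Ne.symm hb]
    · simp
  have h1 : ∀ a, (∑ u : σ → ι with u s = a, ‖q u‖ ^ 2) ^ (((1 : ℕ) : ℝ) / ((1 : ℕ) + 1)) ≤
      2 ^ k * ((∑ y ∈ Y, ‖∑ u : σ → ι with u s = a, q u * ∏ t, y (t, u t)‖) / #Y) := by
    intro a
    have h := sum_fiber_norm_sq_rpow_le hY hY0 (univ.filter fun u : σ → ι => u s = a) φ
      le_rfl (fun u _ => (hdeg u).le) q one_pos
    rw [sum_image hφinj.injOn] at h
    have e1 : ∀ u ∈ univ.filter fun u : σ → ι => u s = a,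
        ‖∑ v ∈ univ.filter (fun u : σ → ι => u s = a) with φ v = φ u, q v‖ ^ 2 = ‖q u‖ ^ 2 := by
      intro u hu
      rw [sum_eq_single_of_mem u (by simpa using hu)]
      intro v hv hne
      exact absurd (hφinj (mem_filter.1 hv).2) hne
    rw [sum_congr rfl e1] at h
    refine h.trans (le_of_eq ?_)
    have e2 : ((4 : ℝ) ^ ((k : ℝ) / ((1 : ℕ) + 1))) = 2 ^ k := by
      rw [show (4 : ℝ) = 2 ^ (2 : ℝ) by norm_num, ← Real.rpow_mul (by norm_num), ← Real.rpow_natCast]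
      congr 1
      push_cast
      ring
    have e3 : ((2 * (1 : ℕ) : ℝ) / ((1 : ℕ) + 1)) = 1 := by norm_num
    rw [e2, e3]
    simp_rw [Real.rpow_one, hmon]
  have h2 : ∀ y ∈ Y, ∑ a, ‖∑ u : σ → ι with u s = a, q u * ∏ t, y (t, u t)‖ ≤ M := by
    intro y hy
    set f : ι → ℂ := fun a => ∑ u : σ → ι with u s = a, q u * ∏ t, y (t, u t) with hf
    have hθ : ∀ a, ∃ θ : ℂ, ‖θ‖ ≤ 1 ∧ θ * f a = ‖f a‖ := by
      intro a
      by_cases h : f a = 0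
      · exact ⟨0, by simp, by simp [h]⟩
      · have hne : (‖f a‖ : ℂ) ≠ 0 := by simpa using h
        refine ⟨(starRingEnd ℂ) (f a) / ‖f a‖, ?_, ?_⟩
        · rw [norm_div, RCLike.norm_conj, Complex.norm_real, norm_norm, div_self (by simpa using h)]
        · rw [div_mul_eq_mul_div, mul_comm, Complex.mul_conj', sq, mul_div_assoc, div_self hne,
            mul_one]
    choose θ hθ1 hθ2 using hθ
    have := hM (fun t a => if t = s then θ a * y (t, a) else y (t, a)) (by
      intro t a
      split_ifs
      · rw [norm_mul, hY1 y hy, mul_one]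
        exact hθ1 a
      · exact (hY1 y hy _).le)
    have e : ∑ u, q u * ∏ t, (if t = s then θ (u t) * y (t, u t) else y (t, u t)) =
        ((∑ a, ‖f a‖ : ℝ) : ℂ) := by
      push_cast
      rw [← sum_fiberwise univ (fun u : σ → ι => u s)]
      refine sum_congr rfl fun a _ => ?_
      rw [← hθ2, hf, mul_sum]
      refine sum_congr rfl fun u hu => ?_
      have hu := (mem_filter.1 hu).2
      have : ∀ t, (if t = s then θ (u t) * y (t, u t) else y (t, u t)) =
          (if t = s then θ a else 1) * y (t, u t) := by
        intro t
        split_ifs with h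
        · rw [h, hu]
        · rw [one_mul]
      simp_rw [this, prod_mul_distrib]
      rw [prod_ite_eq' univ s (fun _ => θ a), if_pos (mem_univ s)]
      ring
    rw [e, Complex.norm_real, Real.norm_of_nonneg (sum_nonneg fun _ _ => norm_nonneg _)] at this
    exact this
  calc _ ≤ ∑ a, 2 ^ k * ((∑ y ∈ Y, ‖∑ u : σ → ι with u s = a, q u * ∏ t, y (t, u t)‖) / #Y) :=
        sum_le_sum fun a _ => h1 a
    _ = 2 ^ k * ((∑ y ∈ Y, ∑ a, ‖∑ u : σ → ι with u s = a, q u * ∏ t, y (t, u t)‖) / #Y) := by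
        rw [← mul_sum, ← sum_div, sum_comm]
    _ ≤ 2 ^ k * M := by
        refine mul_le_mul_of_nonneg_left ?_ (by positivity)
        rw [div_le_iff₀ hc]
        calc _ ≤ ∑ y ∈ Y, M := sum_le_sum h2
          _ = _ := by rw [sum_const, nsmul_eq_mul, mul_comm]

/-- Partial polarization: replacing some of the arguments of a symmetric form by arbitrary vectors
of the polydisc costs a factor `e` per argument. -/
lemma norm_partial_polarization_le {σ ι : Type*} [Fintype σ] [Fintype ι] [DecidableEq σ]
    [DecidableEq ι] (c : (σ → ι) → ℂ) (hc : ∀ (e : Equiv.Perm σ) i, c (i ∘ e) = c i) {M : ℝ}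
    (hM : ∀ y : ι → ℂ, (∀ a, ‖y a‖ ≤ 1) → ‖∑ i, c i * ∏ s, y (i s)‖ ≤ M) (S : Finset σ) :
    ∀ (x : σ → ι → ℂ) (y : ι → ℂ), (∀ s a, ‖x s a‖ ≤ 1) → (∀ a, ‖y a‖ ≤ 1) →
      ‖∑ i, c i * ∏ s, (if s ∈ S then x s (i s) else y (i s))‖ ≤ Real.exp 1 ^ #S * M := by
  induction S using Finset.induction_on with
  | empty =>
    intro x y _ hy
    simpa using hM y hy
  | insert s₀ S hs₀ ih =>
    intro x y hx hy
    have hM0 : 0 ≤ M := (norm_nonneg _).trans (hM 0 (by simp))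
    set n := #(univ.filter fun s => s ∉ S) with hn
    have hn0 : 0 < n := card_pos.2 ⟨s₀, by simpa using hs₀⟩
    have hn' : (0 : ℝ) < n := by exact_mod_cast hn0
    set g : ℂ → ℂ := fun t => ∑ i, c i *
      ∏ s, (if s ∈ S then x s (i s) else y (i s) + t * x s₀ (i s)) with hg
    have hderiv : HasDerivAt g (∑ i, c i * ∑ s, (∏ s' ∈ univ.erase s,
        (if s' ∈ S then x s' (i s') else y (i s') + 0 * x s₀ (i s'))) •
          (if s ∈ S then 0 else x s₀ (i s))) 0 := by
      refine HasDerivAt.fun_sum fun i _ => HasDerivAt.const_mul _ ?_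
      refine HasDerivAt.fun_finsetProd fun s _ => ?_
      split_ifs
      · exact hasDerivAt_const _ _
      · simpa using ((hasDerivAt_id (0 : ℂ)).mul_const (x s₀ (i s))).const_add (y (i s))
    set T : σ → ℂ := fun s => ∑ i, c i *
      ∏ s', (if s' ∈ S then x s' (i s') else if s' = s then x s₀ (i s') else y (i s')) with hT
    have hTsymm : ∀ s ∉ S, T s = T s₀ := by
      intro s hs
      set e := Equiv.swap s s₀ with he
      rw [hT]
      simp only
      rw [← Equiv.sum_comp (Equiv.arrowCongr e (Equiv.refl ι))]
      refine sum_congr rfl fun i _ => ?_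
      have hi : (Equiv.arrowCongr e (Equiv.refl ι)) i = i ∘ e := by
        funext t; simp [he]
      rw [hi, hc]
      congr 1
      rw [← Equiv.prod_comp e]
      refine prod_congr rfl fun t _ => ?_
      simp only [Function.comp_apply]
      by_cases ht : t = s
      · subst ht
        by_cases h : t = s₀
        · subst h
          simp [he, hs]
        · simp [he, hs, hs₀, h, Ne.symm h]
      · by_cases ht' : t = s₀
        · subst ht'
          simp [he, hs, hs₀]
        · have : e t = t := Equiv.swap_apply_of_ne_of_ne ht ht'
          simp only [this, ht, ht', if_false]
    have hval : deriv g 0 = n * T s₀ := by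
      rw [hderiv.deriv]
      simp_rw [mul_sum]
      rw [sum_comm, hn, ← sum_filter_add_sum_filter_not univ (fun s => s ∉ S)]
      rw [sum_congr rfl (g := fun _ => T s₀), sum_const, nsmul_eq_mul, add_eq_left]
      · refine sum_eq_zero fun s hs => sum_eq_zero fun i _ => ?_
        have hs : s ∈ S := by simpa using hs
        simp [hs]
      · intro s hs
        have hs : s ∉ S := by simpa using hs
        rw [← hTsymm s hs, hT]
        refine sum_congr rfl fun i _ => ?_
        congr 1
        rw [← mul_prod_erase univ _ (mem_univ s), smul_eq_mul, mul_comm]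
        simp only [hs, if_false, if_true]
        congr 1
        refine prod_congr rfl fun s' hs' => ?_
        rw [if_neg (ne_of_mem_erase hs')]
        simp
    have hTval : T s₀ = ∑ i, c i * ∏ s, (if s ∈ insert s₀ S then x s (i s) else y (i s)) := by
      rw [hT]
      refine sum_congr rfl fun i _ => ?_
      congr 1
      refine prod_congr rfl fun s _ => ?_
      by_cases h1 : s = s₀
      · subst h1; simp [hs₀]
      · simp [h1]
    have hdiff : Differentiable ℂ g := by
      rw [hg]
      refine Differentiable.fun_sum fun i _ => Differentiable.const_mul ?_ _
      refine Differentiable.fun_finsetProd fun s _ => ?_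
      split_ifs <;> fun_prop
    have hbound : ∀ t ∈ Metric.sphere (0 : ℂ) (1 / n), ‖g t‖ ≤
        Real.exp 1 * (Real.exp 1 ^ #S * M) := by
      intro t ht
      have ht : ‖t‖ = 1 / n := by simpa using ht
      set r : ℝ := 1 + 1 / n with hr
      have hr0 : 0 < r := by positivity
      have hrc : (r : ℂ) ≠ 0 := by exact_mod_cast hr0.ne'
      have hsc : g t = (r : ℂ) ^ n * ∑ i, c i *
          ∏ s, (if s ∈ S then x s (i s) else (y (i s) + t * x s₀ (i s)) / r) := by
        rw [hg, mul_sum]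
        refine sum_congr rfl fun i _ => ?_
        rw [mul_left_comm]
        congr 1
        rw [hn, ← prod_const, prod_filter, ← prod_mul_distrib]
        refine prod_congr rfl fun s _ => ?_
        by_cases h : s ∈ S
        · simp [h]
        · simp only [h, if_false, not_false_eq_true, if_true]
          field_simp
      have h1 := ih x (fun a => (y a + t * x s₀ a) / r) hx (by
        intro a
        rw [norm_div, Complex.norm_real, Real.norm_of_nonneg hr0.le, div_le_one hr0]
        calc ‖y a + t * x s₀ a‖ ≤ ‖y a‖ + ‖t‖ * ‖x s₀ a‖ := by
              rw [← norm_mul]; exact norm_add_le _ _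
          _ ≤ 1 + 1 / n * 1 := by
              rw [ht]
              exact add_le_add (hy a) (mul_le_mul_of_nonneg_left (hx _ _) (by positivity))
          _ = r := by rw [mul_one])
      rw [hsc, norm_mul, norm_pow, Complex.norm_real, Real.norm_of_nonneg hr0.le]
      refine mul_le_mul ?_ h1 (norm_nonneg _) (Real.exp_pos 1).le
      calc r ^ n ≤ Real.exp (1 / n) ^ n := by
            refine pow_le_pow_left₀ hr0.le ?_ n
            rw [hr, add_comm]
            exact Real.add_one_le_exp _
        _ = Real.exp 1 := by
            rw [← Real.exp_nat_mul, mul_one_div_cancel hn'.ne']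
    have hcauchy := Complex.norm_deriv_le_of_forall_mem_sphere_norm_le (c := (0 : ℂ))
      (by positivity : (0 : ℝ) < 1 / n) hdiff.diffContOnCl hbound
    rw [hval, norm_mul, Complex.norm_natCast, div_div_eq_mul_div, div_one, mul_comm] at hcauchy
    rw [← hTval, card_insert_of_notMem hs₀, pow_succ']
    rw [mul_assoc]
    exact le_of_mul_le_mul_right hcauchy hn'

/-- The exponent vector of the monomial indexed by `i`: how often each value is taken. -/
def fiberCount {σ ι : Type*} [Fintype σ] [DecidableEq ι] (i : σ → ι) (a : ι) : ℕ :=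
  #{s | i s = a}

lemma fiberCount_comp_perm {σ ι : Type*} [Fintype σ] [DecidableEq ι] (e : Equiv.Perm σ)
    (i : σ → ι) : fiberCount (i ∘ e) = fiberCount i := by
  funext a
  refine card_bij (fun s _ => e s) ?_ ?_ ?_
  · intro s hs
    simpa using hs
  · intro s _ t _ h
    exact e.injective h
  · intro s hs
    exact ⟨e.symm s, by simpa using hs, by simp⟩

lemma prod_filter_comp_eq_prod_pow {σ ι R : Type*} [Fintype σ] [Fintype ι] [DecidableEq ι]
    [CommMonoid R] (p : σ → Prop) [DecidablePred p] (i : σ → ι) (y : ι → R) :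
    ∏ s with p s, y (i s) = ∏ a, y a ^ #{s | p s ∧ i s = a} := by
  rw [← prod_fiberwise' _ i y]
  refine prod_congr rfl fun a _ => ?_
  rw [prod_const, filter_filter]

lemma card_rearrangements_le {σ ι : Type*} [Fintype σ] [Fintype ι] [DecidableEq σ] [DecidableEq ι]
    (i : σ → ι) (S : Finset σ) :
    #{i' : σ → ι | fiberCount i' = fiberCount i} ≤ Fintype.card σ ^ #S *
      #{i' : σ → ι | (∀ s ∈ S, i' s = i s) ∧ fiberCount i' = fiberCount i} := by
  induction S using Finset.induction_on with
  | empty => simp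
  | insert s₀ S hs₀ ih =>
    refine ih.trans ?_
    rw [card_insert_of_notMem hs₀, pow_succ, mul_assoc]
    refine Nat.mul_le_mul_left _ ?_
    have hsub : (univ.filter fun i' : σ → ι => (∀ s ∈ S, i' s = i s) ∧
        fiberCount i' = fiberCount i) ⊆
        ((univ : Finset σ) ×ˢ (univ.filter fun i' : σ → ι => (∀ s ∈ insert s₀ S, i' s = i s) ∧
          fiberCount i' = fiberCount i)).image
          fun p => p.2 ∘ Equiv.swap p.1 s₀ := by
      intro i' hi'
      obtain ⟨h1, h2⟩ := (mem_filter.1 hi').2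
      obtain ⟨s, hs, hsi⟩ : ∃ s, s ∉ S ∧ i' s = i s₀ := by
        by_contra! hcon
        have hlt : #{s | i' s = i s₀} < #{s | i s = i s₀} := by
          refine card_lt_card ⟨?_, ?_⟩
          · intro s hs
            have hs := (mem_filter.1 hs).2
            have hsS : s ∈ S := by
              by_contra h
              exact hcon s h hs
            simpa [← h1 s hsS] using hs
          · intro hsup
            have := (mem_filter.1 (hsup (mem_filter.2 ⟨mem_univ s₀, rfl⟩))).2
            exact hcon s₀ hs₀ this
        exact hlt.ne (congrFun h2 (i s₀))
      refine mem_image.2 ⟨(s, i' ∘ Equiv.swap s s₀), ?_, ?_⟩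
      · refine mem_product.2 ⟨mem_univ _, mem_filter.2 ⟨mem_univ _, ?_, ?_⟩⟩
        · intro t ht
          rcases mem_insert.1 ht with rfl | ht
          · simp [hsi]
          · have hne : t ≠ s := fun h => hs (h ▸ ht)
            have hne' : t ≠ s₀ := fun h => hs₀ (h ▸ ht)
            simp [Equiv.swap_apply_of_ne_of_ne hne hne', h1 t ht]
        · rw [fiberCount_comp_perm, h2]
      · funext t
        simp
    refine (card_le_card hsub).trans (card_image_le.trans ?_)
    rw [card_product, card_univ]

lemma rpow_div_succ_pow {x : ℝ} (hx : 0 ≤ x) (k r : ℕ) :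
    (x ^ ((r : ℝ) / (k + 1))) ^ (k + 1) = x ^ r := by
  rw [← Real.rpow_natCast, ← Real.rpow_mul hx, ← Real.rpow_natCast]
  congr 1
  push_cast
  field_simp

/-- The mixed `ℓ^{2k/(k+1)}(ℓ²)` norm of the coefficients of a bounded homogeneous polynomial, with
respect to a block `S` of `k` indices. -/
lemma mixed_norm_block_le {σ ι : Type*} [Fintype σ] [Fintype ι] [DecidableEq σ]
    [DecidableEq ι] (c : (σ → ι) → ℂ) (hc : ∀ i i', fiberCount i = fiberCount i' → c i = c i')
    {M : ℝ} (hM : ∀ y : ι → ℂ, (∀ a, ‖y a‖ ≤ 1) → ‖∑ i, c i * ∏ s, y (i s)‖ ≤ M)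
    (S : Finset σ) (hS : 0 < #S) (b : (σ → ι) → ℝ)
    (hb : ∀ i, b i ^ 2 = #{i' : σ → ι | fiberCount i' = fiberCount i} * ‖c i‖ ^ 2) :
    (∑ u : S → ι, (∑ i : σ → ι with (fun s : S => i s) = u, b i ^ 2) ^
        ((#S : ℝ) / (#S + 1))) ^ (#S + 1) ≤
      4 ^ Fintype.card σ * ((Fintype.card σ * (2 * Real.exp 1) ^ 2) ^ #S * M ^ 2) ^ #S := by
  set k := #S with hk
  set m := Fintype.card σ with hm
  obtain ⟨Y, hY0, hY1, hY⟩ := exists_orthogonal_torus_finset ι (2 * m)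
  have hcY : (0 : ℝ) < #Y := by exact_mod_cast hY0.card_pos
  have hM0 : 0 ≤ M := (norm_nonneg _).trans (hM 0 (by simp))
  obtain ⟨φ, hφ⟩ : ∃ φ : (σ → ι) → ι → ℕ, φ = fun i a => #{s | s ∉ S ∧ i s = a} := ⟨_, rfl⟩
  obtain ⟨V, hV⟩ : ∃ V : (S → ι) → Finset (σ → ι),
      V = fun u => univ.filter fun i => (fun s : S => i s) = u := ⟨_, rfl⟩
  have hVmem : ∀ u i, i ∈ V u ↔ (fun s : S => i s) = u := fun u i => by simp [hV]
  have hsplit : ∀ (i : σ → ι) a, fiberCount i a = #{s | s ∈ S ∧ i s = a} + φ i a := by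
    intro i a
    rw [fiberCount, ← card_filter_add_card_filter_not (p := fun s => s ∈ S), filter_filter,
      filter_filter]
    simp only [hφ, and_comm]
  have hSeq : ∀ u, ∀ i ∈ V u, ∀ i' ∈ V u, ∀ s ∈ S, i s = i' s := by
    intro u i hi i' hi' s hs
    exact congrFun (((hVmem _ _).1 hi).trans ((hVmem _ _).1 hi').symm) ⟨s, hs⟩
  have hφeq : ∀ u, ∀ i ∈ V u, ∀ i' ∈ V u, φ i' = φ i ↔ fiberCount i' = fiberCount i := by
    intro u i hi i' hi'
    have h : ∀ a, #{s | s ∈ S ∧ i' s = a} = #{s | s ∈ S ∧ i s = a} := by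
      intro a
      congr 1
      refine filter_congr fun s _ => ?_
      exact and_congr_right fun hs => by rw [hSeq u i hi i' hi' s hs]
    constructor
    · intro h'
      funext a
      rw [hsplit, hsplit, h, h']
    · intro h'
      funext a
      have := congrFun h' a
      rw [hsplit, hsplit, h] at this
      omega
  have hdeg : ∀ i, ∑ a, φ i a ≤ m := by
    intro i
    calc ∑ a, φ i a ≤ ∑ a, fiberCount i a := sum_le_sum fun a _ => by rw [hsplit]; omega
      _ = m := by
        rw [hm, ← card_univ]
        exact (card_eq_sum_card_fiberwise fun _ _ => mem_coe.2 (mem_univ _)).symm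
  obtain ⟨Q, hQ⟩ : ∃ Q : (S → ι) → (ι → ℂ) → ℂ,
      Q = fun u y => ∑ i ∈ V u, c i * ∏ a, y a ^ φ i a := ⟨_, rfl⟩
  obtain ⟨W, hW⟩ : ∃ W : (S → ι) → ℝ,
      W = fun u => ∑ α ∈ (V u).image φ, ‖∑ i ∈ V u with φ i = α, c i‖ ^ 2 := ⟨_, rfl⟩
  have hW0 : ∀ u, 0 ≤ W u := fun u => hW ▸ sum_nonneg fun _ _ => sq_nonneg _
  have hhyp : ∀ u, W u ^ ((k : ℝ) / (k + 1)) ≤ (4 : ℝ) ^ ((m : ℝ) / (k + 1)) *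
      ((∑ y ∈ Y, ‖Q u y‖ ^ ((2 * k : ℝ) / (k + 1))) / #Y) := by
    intro u
    rw [hW, hQ]
    exact sum_fiber_norm_sq_rpow_le hY hY0 (V u) φ le_rfl (fun i _ => hdeg i) c hS
  have hWge : ∀ u, ∑ i ∈ V u, b i ^ 2 ≤ (m : ℝ) ^ k * W u := by
    intro u
    rw [hW, mul_sum, ← sum_fiberwise_of_maps_to (g := φ) (t := (V u).image φ)
      (fun i hi => mem_image_of_mem _ hi)]
    refine sum_le_sum fun α hα => ?_
    obtain ⟨i₀, hi₀, rfl⟩ := mem_image.1 hα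
    obtain ⟨R, hR⟩ : ∃ R, R = (V u).filter fun i => φ i = φ i₀ := ⟨_, rfl⟩
    rw [← hR]
    have hRc : ∀ i ∈ R, fiberCount i = fiberCount i₀ := by
      intro i hi
      rw [hR, mem_filter] at hi
      exact (hφeq u i₀ hi₀ i hi.1).1 hi.2
    have h1 : ∑ i ∈ R, c i = #R * c i₀ := by
      rw [sum_congr rfl fun i hi => hc i i₀ (hRc i hi), sum_const, nsmul_eq_mul]
    have h2 : ∑ i ∈ R, b i ^ 2 = #R * (#{i' : σ → ι | fiberCount i' = fiberCount i₀} * ‖c i₀‖ ^ 2) := by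
      rw [sum_congr rfl (g := fun _ => (#{i' : σ → ι | fiberCount i' = fiberCount i₀} * ‖c i₀‖ ^ 2 : ℝ)),
        sum_const, nsmul_eq_mul]
      intro i hi
      rw [hb, hRc i hi, hc i i₀ (hRc i hi)]
    have h3 : (univ.filter fun i' : σ → ι => (∀ s ∈ S, i' s = i₀ s) ∧
        fiberCount i' = fiberCount i₀) = R := by
      ext i'
      have hV' : i' ∈ V u ↔ ∀ s ∈ S, i' s = i₀ s := by
        constructor
        · intro hi' s hs
          exact hSeq u i' hi' i₀ hi₀ s hs
        · intro h
          rw [hVmem, ← (hVmem u i₀).1 hi₀]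
          funext s
          exact h s s.2
      rw [hR, mem_filter, mem_filter, ← hV']
      constructor
      · rintro ⟨_, h, h'⟩
        exact ⟨h, (hφeq u i₀ hi₀ i' h).2 h'⟩
      · rintro ⟨h, h'⟩
        exact ⟨mem_univ _, h, (hφeq u i₀ hi₀ i' h).1 h'⟩
    have h4 := card_rearrangements_le i₀ S
    rw [h3] at h4
    have h4 : (#{i' : σ → ι | fiberCount i' = fiberCount i₀} : ℝ) ≤ (m : ℝ) ^ k * #R := by
      exact_mod_cast h4
    rw [h1, h2, norm_mul, Complex.norm_natCast, mul_pow]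
    calc _ ≤ (#R : ℝ) * ((m : ℝ) ^ k * #R * ‖c i₀‖ ^ 2) :=
          mul_le_mul_of_nonneg_left (mul_le_mul_of_nonneg_right h4 (sq_nonneg _))
            (Nat.cast_nonneg _)
      _ = _ := by ring
  have hQbound : ∀ y ∈ Y, ∑ u, ‖Q u y‖ ^ ((2 * k : ℝ) / (k + 1)) ≤
      (((2 * Real.exp 1) ^ k * M) ^ 2) ^ ((k : ℝ) / (k + 1)) := by
    intro y hy
    have hml := multilinear_bohnenblust_hille (σ := S) (k := k) (Fintype.card_coe S) hS
      (fun u => Q u y) (M := Real.exp 1 ^ k * M) (by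
        intro x hx
        have := norm_partial_polarization_le c
          (fun e i => hc _ _ (fiberCount_comp_perm e i)) hM S
          (fun s a => if h : s ∈ S then x ⟨s, h⟩ a else 0) y
          (fun s a => by
            split_ifs with h
            · exact hx _ _
            · simp) (fun a => (hY1 y hy a).le)
        refine le_trans (le_of_eq ?_) this
        congr 1
        rw [← sum_fiberwise univ (fun i : σ → ι => fun s : S => i s)]
        refine sum_congr rfl fun u _ => ?_
        simp only [hQ]
        rw [sum_mul]
        refine sum_congr (by rw [hV]) fun i hi => ?_
        have hi := (mem_filter.1 hi).2
        rw [prod_ite, mul_assoc, mul_comm (∏ a, y a ^ φ i a), prod_filter_comp_eq_prod_pow]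
        congr 2
        swap
        · rw [hφ]
        rw [filter_mem_eq_inter, univ_inter]
        refine Eq.trans (prod_congr rfl fun s _ => ?_) (prod_coe_sort S fun s =>
          if h : s ∈ S then x ⟨s, h⟩ (i s) else 0)
        rw [dif_pos s.2, ← hi])
    have h0 : 0 ≤ ∑ u, ‖Q u y‖ ^ ((2 * k : ℝ) / (k + 1)) :=
      sum_nonneg fun u _ => Real.rpow_nonneg (norm_nonneg _) _
    refine le_of_pow_le_pow_left₀ (Nat.succ_ne_zero k) (Real.rpow_nonneg (sq_nonneg _) _) ?_
    rw [Nat.succ_eq_add_one, rpow_div_succ_pow (sq_nonneg _)]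
    refine hml.trans (le_of_eq ?_)
    rw [← pow_mul, mul_pow 2 (Real.exp 1)]
    ring
  have hfin : ∑ u : S → ι, (∑ i ∈ V u, b i ^ 2) ^ ((k : ℝ) / (k + 1)) ≤
      ((m : ℝ) ^ k) ^ ((k : ℝ) / (k + 1)) * ((4 : ℝ) ^ ((m : ℝ) / (k + 1)) *
        (((2 * Real.exp 1) ^ k * M) ^ 2) ^ ((k : ℝ) / (k + 1))) := by
    have hθ : (0 : ℝ) ≤ (k : ℝ) / (k + 1) := div_nonneg k.cast_nonneg k.cast_add_one_pos.le
    have hmk : (0 : ℝ) ≤ (m : ℝ) ^ k := pow_nonneg m.cast_nonneg _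
    calc _ ≤ ∑ u : S → ι, ((m : ℝ) ^ k) ^ ((k : ℝ) / (k + 1)) * ((4 : ℝ) ^ ((m : ℝ) / (k + 1)) *
          ((∑ y ∈ Y, ‖Q u y‖ ^ ((2 * k : ℝ) / (k + 1))) / #Y)) := by
          refine sum_le_sum fun u _ => ?_
          calc _ ≤ ((m : ℝ) ^ k * W u) ^ ((k : ℝ) / (k + 1)) :=
                Real.rpow_le_rpow (sum_nonneg fun _ _ => sq_nonneg _) (hWge u) hθ
            _ = ((m : ℝ) ^ k) ^ ((k : ℝ) / (k + 1)) * W u ^ ((k : ℝ) / (k + 1)) :=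
                Real.mul_rpow hmk (hW0 u)
            _ ≤ _ := mul_le_mul_of_nonneg_left (hhyp u) (Real.rpow_nonneg hmk _)
      _ = ((m : ℝ) ^ k) ^ ((k : ℝ) / (k + 1)) * ((4 : ℝ) ^ ((m : ℝ) / (k + 1)) *
          ((∑ y ∈ Y, ∑ u, ‖Q u y‖ ^ ((2 * k : ℝ) / (k + 1))) / #Y)) := by
          rw [← mul_sum, ← mul_sum, ← sum_div, sum_comm]
      _ ≤ _ := by
          refine mul_le_mul_of_nonneg_left (mul_le_mul_of_nonneg_left ?_
            (Real.rpow_nonneg zero_le_four _)) (Real.rpow_nonneg hmk _)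
          rw [div_le_iff₀ hcY]
          refine (sum_le_sum hQbound).trans (le_of_eq ?_)
          rw [sum_const, nsmul_eq_mul, mul_comm]
  rw [hV] at hfin
  calc _ ≤ (((m : ℝ) ^ k) ^ ((k : ℝ) / (k + 1)) * ((4 : ℝ) ^ ((m : ℝ) / (k + 1)) *
        (((2 * Real.exp 1) ^ k * M) ^ 2) ^ ((k : ℝ) / (k + 1)))) ^ (k + 1) :=
        pow_le_pow_left₀ (sum_nonneg fun u _ => Real.rpow_nonneg
          (sum_nonneg fun _ _ => sq_nonneg _) _) hfin _
    _ = _ := by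
        rw [mul_pow, mul_pow, rpow_div_succ_pow (pow_nonneg m.cast_nonneg _),
          rpow_div_succ_pow zero_le_four, rpow_div_succ_pow (sq_nonneg _)]
        rw [mul_left_comm, ← mul_pow]
        congr 2
        rw [mul_pow _ M, mul_pow (m : ℝ), ← mul_assoc, ← pow_mul, ← pow_mul, mul_comm k 2]

lemma sum_homogenization_eq {τ κ : Type*} [Fintype κ] (T : Finset τ) (a : τ → ℂ)
    (α : τ → κ → ℕ) {d : ℕ} (hα : ∀ t ∈ T, ∑ i, α t i ≤ d) (w : ℂ) (y : κ → ℂ) :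
    ∑ t ∈ T, a t * (w ^ (d - ∑ i, α t i) * ∏ i, (w * y i) ^ α t i) =
      w ^ d * ∑ t ∈ T, a t * ∏ i, y i ^ α t i := by
  rw [mul_sum]
  refine sum_congr rfl fun t ht => ?_
  have h : w ^ d = w ^ (d - ∑ i, α t i) * ∏ i, w ^ α t i := by
    rw [prod_pow_eq_pow_sum, ← pow_add, Nat.sub_add_cancel (hα t ht)]
  simp only [mul_pow, prod_mul_distrib]
  rw [h]
  ring

lemma norm_le_of_norm_le_on_circle {f : ℂ → ℂ} (hf : Differentiable ℂ f) {M : ℝ}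
    (hM : ∀ w, ‖w‖ = 1 → ‖f w‖ ≤ M) {w : ℂ} (hw : ‖w‖ ≤ 1) : ‖f w‖ ≤ M := by
  refine Complex.norm_le_of_forall_mem_frontier_norm_le (U := Metric.ball 0 1)
    Metric.isBounded_ball hf.diffContOnCl (fun z hz => hM z ?_) ?_
  · rw [frontier_ball _ one_ne_zero] at hz
    simpa using hz
  · rw [closure_ball _ one_ne_zero]
    simpa using hw

/-- A real polynomial of degree at most `d` that is bounded by `M` on the real cube is bounded by
`(1 + √2) ^ d * M` on the complex polydisc. -/
lemma norm_complexification_le {τ κ : Type*} [Fintype κ] (T : Finset τ) (a : τ → ℝ)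
    (α : τ → κ → ℕ) {d : ℕ} (hα : ∀ t ∈ T, ∑ i, α t i ≤ d) {M : ℝ}
    (hM : ∀ x : κ → ℝ, (∀ i, x i ∈ Set.Icc (-1 : ℝ) 1) → |∑ t ∈ T, a t * ∏ i, x i ^ α t i| ≤ M)
    (z : κ → ℂ) (hz : ∀ i, ‖z i‖ ≤ 1) :
    ‖∑ t ∈ T, (a t : ℂ) * ∏ i, z i ^ α t i‖ ≤ (1 + Real.sqrt 2) ^ d * M := by
  have hs : Real.sqrt 2 ^ 2 = 2 := Real.sq_sqrt zero_le_two
  have hs0 : 0 < Real.sqrt 2 := Real.sqrt_pos.2 zero_lt_two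
  have hs1 : 1 < Real.sqrt 2 := by nlinarith
  have hsC : (Real.sqrt 2 : ℂ) ^ 2 = 2 := by exact_mod_cast hs
  have hs0C : (Real.sqrt 2 : ℂ) ≠ 0 := by exact_mod_cast hs0.ne'
  set p : κ → ℂ → ℂ := fun i ζ => (z i).re * (ζ ^ 2 + 1) / (2 * Real.sqrt 2) +
    Complex.I * (z i).im * (1 - ζ ^ 2) / 2 with hp
  have hG : ∀ ζ : ℂ, ‖ζ‖ ≤ 1 →
      ‖∑ t ∈ T, (a t : ℂ) * (ζ ^ (d - ∑ i, α t i) * ∏ i, p i ζ ^ α t i)‖ ≤ M := by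
    intro ζ hζ
    refine norm_le_of_norm_le_on_circle (f := fun ζ => ∑ t ∈ T, (a t : ℂ) *
      (ζ ^ (d - ∑ i, α t i) * ∏ i, p i ζ ^ α t i)) (by fun_prop) (fun w hw => ?_) hζ
    set x : κ → ℝ := fun i => (z i).re * w.re / Real.sqrt 2 + (z i).im * w.im with hx
    have hw2 : w.re ^ 2 + w.im ^ 2 = 1 := by
      have := Complex.sq_norm w
      rw [hw, Complex.normSq_apply] at this
      linarith
    have hww : w * (starRingEnd ℂ) w = 1 := by
      rw [Complex.mul_conj, Complex.normSq_apply, ← sq, ← sq, hw2, Complex.ofReal_one]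
    have hpx : ∀ i, p i w = w * x i := by
      intro i
      have h1 : w ^ 2 + 1 = w * (2 * w.re) := by
        have := Complex.add_conj w
        push_cast at this
        rw [← this, mul_add, hww, sq]
      have h2 : 1 - w ^ 2 = - w * (2 * w.im * Complex.I) := by
        have := Complex.sub_conj w
        push_cast at this
        rw [← this, neg_mul, mul_sub, hww, sq]
        ring
      simp only [hp, hx]
      rw [h1, h2]
      push_cast
      field_simp
      linear_combination (-(z i).im * w.im * w * Real.sqrt 2 : ℂ) * Complex.I_sq
    have hx1 : ∀ i, x i ∈ Set.Icc (-1 : ℝ) 1 := by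
      intro i
      rw [Set.mem_Icc, ← abs_le, ← sq_le_one_iff_abs_le_one]
      have hz2 : (z i).re ^ 2 + (z i).im ^ 2 ≤ 1 := by
        have := Complex.sq_norm (z i)
        rw [Complex.normSq_apply] at this
        nlinarith [hz i, norm_nonneg (z i)]
      have hd : (w.re / Real.sqrt 2) ^ 2 = w.re ^ 2 / 2 := by rw [div_pow, hs]
      have hxi : x i = (z i).re * (w.re / Real.sqrt 2) + (z i).im * w.im := by
        simp only [hx]
        ring
      rw [hxi]
      have hv : (w.re / Real.sqrt 2) ^ 2 + w.im ^ 2 ≤ 1 := by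
        rw [hd]
        nlinarith [sq_nonneg w.re]
      calc _ ≤ ((z i).re ^ 2 + (z i).im ^ 2) * ((w.re / Real.sqrt 2) ^ 2 + w.im ^ 2) := by
            nlinarith [sq_nonneg ((z i).re * w.im - (z i).im * (w.re / Real.sqrt 2))]
        _ ≤ 1 := mul_le_one₀ hz2 (by positivity) hv
    have hsum := sum_homogenization_eq T (fun t => (a t : ℂ)) α hα w (fun i => (x i : ℂ))
    simp only [hpx]
    rw [hsum, norm_mul, norm_pow, hw, one_pow, one_mul]
    have := hM x hx1
    rw [← Real.norm_eq_abs, ← Complex.norm_real] at this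
    push_cast at this
    exact this
  set ζ₀ : ℝ := Real.sqrt 2 - 1 with hζ₀
  have hζ0 : 0 < ζ₀ := by linarith
  have hpz : ∀ i, p i ζ₀ = ζ₀ * z i := by
    intro i
    have h1 : (ζ₀ : ℂ) ^ 2 + 1 = 2 * Real.sqrt 2 * ζ₀ := by
      rw [hζ₀]
      push_cast
      linear_combination -hsC
    have h2 : 1 - (ζ₀ : ℂ) ^ 2 = 2 * ζ₀ := by
      rw [hζ₀]
      push_cast
      linear_combination -hsC
    simp only [hp]
    rw [h1, h2]
    conv_rhs => rw [← Complex.re_add_im (z i)]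
    field_simp
  have hfin := hG ζ₀ (by
    rw [Complex.norm_real, Real.norm_eq_abs, abs_of_pos hζ0]
    nlinarith)
  simp only [hpz] at hfin
  rw [sum_homogenization_eq T (fun t => (a t : ℂ)) α hα, norm_mul, norm_pow, Complex.norm_real,
    Real.norm_eq_abs, abs_of_pos hζ0] at hfin
  have hinv : (1 + Real.sqrt 2) * ζ₀ = 1 := by
    rw [hζ₀]
    linear_combination hs
  calc _ = (1 + Real.sqrt 2) ^ d * (ζ₀ ^ d * ‖∑ t ∈ T, (a t : ℂ) * ∏ i, z i ^ α t i‖) := by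
        rw [← mul_assoc, ← mul_pow, hinv, one_pow, one_mul]
    _ ≤ _ := by gcongr

lemma norm_homogenization_le {τ κ : Type*} [Fintype κ] (T : Finset τ) (a : τ → ℂ)
    (α : τ → κ → ℕ) {d : ℕ} (hα : ∀ t ∈ T, ∑ i, α t i ≤ d) {M : ℝ}
    (hM : ∀ z : κ → ℂ, (∀ i, ‖z i‖ ≤ 1) → ‖∑ t ∈ T, a t * ∏ i, z i ^ α t i‖ ≤ M)
    {w : ℂ} (hw : ‖w‖ ≤ 1) (z : κ → ℂ) (hz : ∀ i, ‖z i‖ ≤ 1) :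
    ‖∑ t ∈ T, a t * (w ^ (d - ∑ i, α t i) * ∏ i, z i ^ α t i)‖ ≤ M := by
  refine norm_le_of_norm_le_on_circle (f := fun w => ∑ t ∈ T, a t *
      (w ^ (d - ∑ i, α t i) * ∏ i, z i ^ α t i)) (by fun_prop) (fun w hw => ?_) hw
  have hw0 : w ≠ 0 := norm_ne_zero_iff.1 (hw ▸ one_ne_zero)
  have h := sum_homogenization_eq T a α hα w (fun i => w⁻¹ * z i)
  simp only [mul_inv_cancel_left₀ hw0] at h
  rw [h, norm_mul, norm_pow, hw, one_pow, one_mul]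
  exact hM _ fun i => by simpa [hw] using hz i

lemma sum_fiberCount {σ ι : Type*} [Fintype σ] [Fintype ι] [DecidableEq ι] (i : σ → ι) :
    ∑ a, fiberCount i a = Fintype.card σ := by
  rw [← card_univ]
  exact (card_eq_sum_card_fiberwise fun _ _ => mem_coe.2 (mem_univ _)).symm

lemma exists_fiberCount_eq {σ ι : Type*} [Fintype σ] [Fintype ι] [DecidableEq ι] (f : ι → ℕ)
    (hf : ∑ a, f a = Fintype.card σ) : ∃ i : σ → ι, fiberCount i = f := by
  have hcard : Fintype.card σ = Fintype.card (Σ a, Fin (f a)) := by simp [hf]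
  obtain ⟨e⟩ := Fintype.card_eq.1 hcard
  refine ⟨fun s => (e s).1, funext fun a => ?_⟩
  rw [← Fintype.card_fin (f a), ← card_univ]
  symm
  refine card_bij (fun x _ => e.symm ⟨a, x⟩) ?_ ?_ ?_
  · intro x _
    simp
  · intro x _ x' _ h
    simpa using h
  · intro s hs
    obtain rfl := (mem_filter.1 hs).2
    exact ⟨(e s).2, mem_univ _, by simp⟩

lemma sum_div_card_fiber {I τ 𝕜 : Type*} [Fintype I] [DecidableEq τ] [Field 𝕜] [CharZero 𝕜]
    (β : I → τ) (T : Finset τ) (hT : ∀ t ∈ T, ∃ i, β i = t) (g : τ → 𝕜)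
    (hg : ∀ t, t ∉ T → g t = 0) :
    ∑ i, g (β i) / #{i' | β i' = β i} = ∑ t ∈ T, g t := by
  have h : ∀ t ∈ T, g t = ∑ i, if β i = t then g (β i) / #{i' | β i' = β i} else 0 := by
    intro t ht
    obtain ⟨i₀, hi₀⟩ := hT t ht
    have hne : (#{i' | β i' = t} : 𝕜) ≠ 0 := by
      exact_mod_cast (card_pos.2 ⟨i₀, by simpa using hi₀⟩).ne'
    rw [← sum_filter, sum_congr rfl (g := fun _ => g t / #{i' | β i' = t}), sum_const,
      nsmul_eq_mul, mul_div_cancel₀ _ hne]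
    intro i hi
    rw [(mem_filter.1 hi).2]
  rw [sum_congr rfl h, sum_comm]
  refine sum_congr rfl fun i _ => ?_
  rw [sum_ite_eq]
  split_ifs with hi
  · rfl
  · rw [hg _ hi, zero_div]

lemma sum_rpow_le_of_blocks {σ ι J : Type*} [Fintype σ] [Fintype ι] [Fintype J] [DecidableEq σ]
    [DecidableEq ι] [DecidableEq J] (c : (σ → ι) → ℂ)
    (hc : ∀ i i', fiberCount i = fiberCount i' → c i = c i')
    {M : ℝ} (hM : ∀ y : ι → ℂ, (∀ a, ‖y a‖ ≤ 1) → ‖∑ i, c i * ∏ s, y (i s)‖ ≤ M)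
    (hσ : 0 < Fintype.card σ) (blk : σ → J) {K : ℕ} (hblk : ∀ j, 0 < #{s | blk s = j})
    (hK : ∀ j, #{s | blk s = j} ≤ K) (b : (σ → ι) → ℝ) (hb0 : ∀ i, 0 ≤ b i)
    (hb : ∀ i, b i ^ 2 = #{i' : σ → ι | fiberCount i' = fiberCount i} * ‖c i‖ ^ 2) :
    (∑ i, b i ^ ((2 * Fintype.card σ : ℝ) / (Fintype.card σ + 1))) ^ (Fintype.card σ + 1) ≤
      (2 ^ Fintype.card J * (Real.sqrt (Fintype.card σ) * (2 * Real.exp 1)) ^ K * M) ^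
        (2 * Fintype.card σ) := by
  obtain ⟨m, hm⟩ : ∃ m, m = Fintype.card σ := ⟨_, rfl⟩
  obtain ⟨S, hS⟩ : ∃ S : J → Finset σ, S = fun j => univ.filter fun s => blk s = j := ⟨_, rfl⟩
  have hSj : ∀ j, univ.filter (fun s => blk s = j) = S j := fun j => by rw [hS]
  simp only [hSj] at hblk hK
  rw [← hm] at hσ ⊢
  have hsum : ∑ j, #(S j) = m := by
    rw [hm, ← card_univ, hS]
    exact (card_eq_sum_card_fiberwise fun _ _ => mem_coe.2 (mem_univ _)).symm
  have hM0 : 0 ≤ M := (norm_nonneg _).trans (hM 0 (by simp))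
  obtain ⟨D, hD⟩ : ∃ D : ℝ, D = m * (2 * Real.exp 1) ^ 2 := ⟨_, rfl⟩
  have hD1 : 1 ≤ D := by
    have h1 : (1 : ℝ) ≤ m := by exact_mod_cast hσ
    have h2 : (1 : ℝ) ≤ 2 * Real.exp 1 := by linarith [Real.add_one_le_exp 1]
    rw [hD]
    exact one_le_mul_of_one_le_of_one_le h1 (one_le_pow₀ h2)
  have hD0 : 0 ≤ D := zero_le_one.trans hD1
  have hblei := sum_rpow_le_prod_mixed (X := fun j => S j → ι)
    (fun j (i : σ → ι) => fun s : S j => i s) (fun i i' h => funext fun s => by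
      have hs : s ∈ S (blk s) := by simp [hS]
      exact congrFun (h (blk s)) ⟨s, hs⟩) (fun j => #(S j)) m hsum hσ b hb0
  refine hblei.trans ?_
  have hj : ∀ j, (∑ u : S j → ι, (∑ i : σ → ι with (fun s : S j => i s) = u, b i ^ 2) ^
      ((#(S j) : ℝ) / (#(S j) + 1))) ^ (#(S j) + 1) ≤ 4 ^ m * (D ^ K * M ^ 2) ^ #(S j) := by
    intro j
    refine (mixed_norm_block_le c hc hM (S j) (hblk j) b hb).trans ?_
    rw [← hm, ← hD]
    exact mul_le_mul_of_nonneg_left (pow_le_pow_left₀ (mul_nonneg (pow_nonneg hD0 _) (sq_nonneg _))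
      (mul_le_mul_of_nonneg_right (pow_le_pow_right₀ hD1 (hK j)) (sq_nonneg _)) _)
      (pow_nonneg zero_le_four _)
  refine (prod_le_prod (fun j _ => pow_nonneg (sum_nonneg fun _ _ => Real.rpow_nonneg
    (sum_nonneg fun _ _ => sq_nonneg _) _) _) fun j _ => hj j).trans (le_of_eq ?_)
  rw [prod_mul_distrib, prod_const, card_univ, prod_pow_eq_pow_sum, hsum, pow_mul _ 2 m,
    mul_pow _ M, mul_pow (2 ^ _), mul_pow, mul_pow (_ * _) (M ^ 2), mul_pow (_ ^ 2)]
  have h4 : ((4 : ℝ) ^ m) ^ Fintype.card J = ((2 ^ Fintype.card J) ^ 2) ^ m := by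
    rw [← pow_mul 2, mul_comm _ 2, pow_mul 2 2, ← pow_mul, ← pow_mul, mul_comm m]
    norm_num
  have hD' : D ^ K = ((Real.sqrt m * (2 * Real.exp 1)) ^ K) ^ 2 := by
    rw [hD, ← pow_mul, mul_comm K 2, pow_mul, mul_pow (Real.sqrt m), Real.sq_sqrt m.cast_nonneg]
  rw [h4, hD', ← mul_assoc]

lemma exists_block_map {d K : ℕ} (hd : 0 < d) (hK : 0 < K) :
    ∃ blk : Fin d → Fin ((d - 1) / K + 1), ∀ j, 0 < #{s | blk s = j} ∧ #{s | blk s = j} ≤ K := by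
  refine ⟨fun s => ⟨s / K, Nat.lt_succ_of_le (Nat.div_le_div_right (by omega))⟩, fun j => ⟨?_, ?_⟩⟩
  · have hj : (j : ℕ) * K ≤ d - 1 := (Nat.le_div_iff_mul_le hK).1 (Nat.le_of_lt_succ j.2)
    refine card_pos.2 ⟨⟨j * K, by omega⟩, ?_⟩
    rw [mem_filter]
    exact ⟨mem_univ _, Fin.ext (Nat.mul_div_cancel _ hK)⟩
  · calc _ ≤ #(range K) := by
          refine card_le_card_of_injOn (fun s => (s : ℕ) % K)
            (fun s _ => by simpa using Nat.mod_lt _ hK) ?_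
          intro s hs s' hs' h
          have h1 : (s : ℕ) / K = j := congrArg Fin.val (mem_filter.1 (mem_coe.1 hs)).2
          have h2 : (s' : ℕ) / K = j := congrArg Fin.val (mem_filter.1 (mem_coe.1 hs')).2
          refine Fin.ext ?_
          rw [← Nat.div_add_mod s K, ← Nat.div_add_mod s' K, h1, h2]
          exact congrArg _ h
      _ = K := card_range K

/-- The Bohnenblust–Hille inequality for a polynomial of degree at most `d` whose homogenization is
bounded by `M` on the polydisc, with a free block length `K`. -/
lemma bohnenblust_hille_of_homogenization {κ : Type*} [Fintype κ] [DecidableEq κ]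
    (T : Finset (κ → ℕ)) (a : (κ → ℕ) → ℝ) {d : ℕ} (hd : 0 < d) (hT : ∀ t ∈ T, ∑ i, t i ≤ d)
    {M : ℝ} (hM : ∀ (w : ℂ) (z : κ → ℂ), ‖w‖ ≤ 1 → (∀ i, ‖z i‖ ≤ 1) →
      ‖∑ t ∈ T, (a t : ℂ) * (w ^ (d - ∑ i, t i) * ∏ i, z i ^ t i)‖ ≤ M) {K : ℕ} (hK : 0 < K) :
    (∑ t ∈ T, |a t| ^ ((2 * d : ℝ) / (d + 1))) ^ (d + 1) ≤
      (2 ^ ((d - 1) / K + 1) * (Real.sqrt d * (2 * Real.exp 1)) ^ K * M) ^ (2 * d) := by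
  obtain ⟨a', ha'⟩ : ∃ a' : (κ → ℕ) → ℝ, a' = fun t => if t ∈ T then a t else 0 := ⟨_, rfl⟩
  have ha'T : ∀ t ∈ T, a' t = a t := fun t ht => by simp only [ha', if_pos ht]
  have ha'0 : ∀ t, t ∉ T → a' t = 0 := fun t ht => by simp only [ha', if_neg ht]
  obtain ⟨β, hβ⟩ : ∃ β : (Fin d → Option κ) → κ → ℕ, β = fun i k => fiberCount i (some k) :=
    ⟨_, rfl⟩
  have hnone : ∀ i, fiberCount i none = d - ∑ k, β i k := by
    intro i
    have := sum_fiberCount i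
    rw [Fintype.sum_option, Fintype.card_fin] at this
    simp only [hβ]
    omega
  have hβeq : ∀ i i', fiberCount i' = fiberCount i ↔ β i' = β i := by
    intro i i'
    constructor
    · intro h
      rw [hβ]
      simp only [h]
    · intro h
      funext o
      cases o with
      | none => rw [hnone, hnone, h]
      | some k =>
        have := congrFun h k
        rwa [hβ] at this
  have hsurj : ∀ t ∈ T, ∃ i, β i = t := by
    intro t ht
    obtain ⟨i, hi⟩ := exists_fiberCount_eq (σ := Fin d)
      (fun o : Option κ => o.elim (d - ∑ k, t k) t) (by
        rw [Fintype.sum_option, Fintype.card_fin]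
        exact Nat.sub_add_cancel (hT t ht))
    exact ⟨i, by simp only [hβ, hi]; rfl⟩
  obtain ⟨μ, hμ⟩ : ∃ μ : (Fin d → Option κ) → ℕ, μ = fun i => #{i' | β i' = β i} := ⟨_, rfl⟩
  have hμ1 : ∀ i, (1 : ℝ) ≤ μ i := by
    intro i
    have : 0 < μ i := by
      rw [hμ]
      exact card_pos.2 ⟨i, by simp⟩
    exact_mod_cast this
  have hμ0 : ∀ i, (0 : ℝ) < μ i := fun i => zero_lt_one.trans_le (hμ1 i)
  have hμeq : ∀ i : Fin d → Option κ, #{i' : Fin d → Option κ | fiberCount i' = fiberCount i} = μ i := by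
    intro i
    rw [hμ]
    simp only [hβeq]
  have hprod : ∀ (i : Fin d → Option κ) (y : Option κ → ℂ),
      ∏ s, y (i s) = y none ^ (d - ∑ k, β i k) * ∏ k, y (some k) ^ β i k := by
    intro i y
    have := prod_filter_comp_eq_prod_pow (fun _ => True) i y
    simp only [filter_true, true_and, Fintype.prod_option] at this
    rw [this, ← hnone, hβ]
    rfl
  obtain ⟨blk, hblk⟩ := exists_block_map hd hK
  have hmain := sum_rpow_le_of_blocks (σ := Fin d) (M := M)
    (fun i => (a' (β i) : ℂ) / μ i) (fun i i' h => by
      have h' := (hβeq i i').1 h.symm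
      simp only [hμ, h']) (fun y hy => by
      have := sum_div_card_fiber β T hsurj
        (fun t => (a' t : ℂ) * (y none ^ (d - ∑ i, t i) * ∏ i, y (some i) ^ t i))
        (fun t ht => by rw [ha'0 t ht]; simp)
      refine le_trans (le_of_eq (congrArg _ ?_)) (hM (y none) (fun k => y (some k)) (hy _)
        fun k => hy _)
      refine Eq.trans (sum_congr rfl fun i _ => ?_)
        (this.trans (sum_congr rfl fun t ht => by rw [ha'T t ht]))
      rw [hprod, hμ, div_mul_eq_mul_div]) (by simpa using hd) blk (fun j => (hblk j).1)
    (fun j => (hblk j).2) (fun i => |a' (β i)| / Real.sqrt (μ i))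
    (fun i => div_nonneg (abs_nonneg _) (Real.sqrt_nonneg _)) (fun i => by
      have := (hμ0 i).ne'
      rw [hμeq, norm_div, Complex.norm_natCast, Complex.norm_real, Real.norm_eq_abs, div_pow,
        Real.sq_sqrt (hμ0 i).le, div_pow]
      field_simp)
  simp only [Fintype.card_fin] at hmain
  refine le_trans (pow_le_pow_left₀ (sum_nonneg fun t _ => Real.rpow_nonneg (abs_nonneg _) _) ?_ _)
    hmain
  obtain ⟨p, hp⟩ : ∃ p : ℝ, p = (2 * d : ℝ) / (d + 1) := ⟨_, rfl⟩
  have hd0 : (0 : ℝ) < d := by exact_mod_cast hd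
  have hp0 : 0 < p := hp ▸ by positivity
  have hp2 : p / 2 ≤ 1 := by
    rw [hp, div_div, div_le_one (by positivity)]
    linarith
  rw [← hp]
  calc ∑ t ∈ T, |a t| ^ p = ∑ t ∈ T, |a' t| ^ p := sum_congr rfl fun t ht => by rw [ha'T t ht]
    _ = ∑ i, |a' (β i)| ^ p / μ i := by
        rw [← sum_div_card_fiber β T hsurj (fun t => |a' t| ^ p) fun t ht => by
          rw [ha'0 t ht, abs_zero, Real.zero_rpow hp0.ne'], hμ]
    _ ≤ _ := by
        refine sum_le_sum fun i _ => ?_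
        rw [Real.div_rpow (abs_nonneg _) (Real.sqrt_nonneg _)]
        refine div_le_div_of_nonneg_left (Real.rpow_nonneg (abs_nonneg _) _)
          (Real.rpow_pos_of_pos (Real.sqrt_pos.2 (hμ0 i)) _) ?_
        rw [Real.sqrt_eq_rpow, ← Real.rpow_mul (hμ0 i).le]
        calc (μ i : ℝ) ^ (1 / 2 * p) ≤ (μ i : ℝ) ^ (1 : ℝ) :=
              Real.rpow_le_rpow_of_exponent_le (hμ1 i) (by linarith)
          _ = μ i := Real.rpow_one _

/-- With blocks of length about `√(d / log d)` the constant is subexponential in `d`. -/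
lemma exists_block_length_bound {d : ℕ} (hd : 2 ≤ d) :
    ∃ K : ℕ, 0 < K ∧ (2 : ℝ) ^ ((d - 1) / K + 1) * (Real.sqrt d * (2 * Real.exp 1)) ^ K ≤
      Real.exp 11 ^ Real.sqrt (d * Real.log d) := by
  have hd2 : (2 : ℝ) ≤ d := by exact_mod_cast hd
  have hd0 : (0 : ℝ) < d := by linarith
  obtain ⟨L, hL⟩ : ∃ L, L = Real.log d := ⟨_, rfl⟩
  have hL2 : 1 / 2 < L := by
    have := Real.log_two_gt_d9
    have := Real.log_le_log zero_lt_two hd2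
    rw [hL]
    linarith
  have hL0 : 0 < L := by linarith
  have hLd : L ≤ d := by
    have := Real.log_le_sub_one_of_pos hd0
    rw [hL]
    linarith
  rw [← hL]
  obtain ⟨t, ht⟩ : ∃ t, t = Real.sqrt (d * L) := ⟨_, rfl⟩
  have ht2 : t ^ 2 = d * L := by rw [ht, Real.sq_sqrt (by positivity)]
  have ht0 : 0 ≤ t := ht ▸ Real.sqrt_nonneg _
  have ht1 : 1 ≤ t := by
    rw [ht, Real.one_le_sqrt]
    nlinarith
  have hLt : L ≤ t := by
    rw [ht]
    exact Real.le_sqrt_of_sq_le (by nlinarith)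
  have hK0 : 0 < t / L := by positivity
  refine ⟨⌈t / L⌉₊, Nat.ceil_pos.2 hK0, ?_⟩
  obtain ⟨K, hK⟩ : ∃ K, K = ⌈t / L⌉₊ := ⟨_, rfl⟩
  rw [← hK, ← ht]
  have hK1 : t / L ≤ K := hK ▸ Nat.le_ceil _
  have hK2 : (K : ℝ) < t / L + 1 := hK ▸ Nat.ceil_lt_add_one hK0.le
  have hKL : K * L ≤ 2 * t := by
    have : (K : ℝ) * L ≤ (t / L + 1) * L := mul_le_mul_of_nonneg_right hK2.le hL0.le
    rw [add_mul, div_mul_cancel₀ _ hL0.ne'] at this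
    linarith
  have hK4 : (K : ℝ) ≤ 4 * t := by
    have : (0 : ℝ) ≤ K := K.cast_nonneg
    nlinarith
  have hKpos : (0 : ℝ) < K := hK0.trans_le hK1
  have hl : (((d - 1) / K + 1 : ℕ) : ℝ) ≤ 2 * t := by
    have h1 : (((d - 1) / K : ℕ) : ℝ) ≤ d / K := by
      refine Nat.cast_div_le.trans ?_
      gcongr
      omega
    have h2 : (d : ℝ) / K ≤ t := by
      rw [div_le_iff₀ hKpos]
      rw [div_le_iff₀ hL0] at hK1
      have : t * t ≤ t * (K * L) := mul_le_mul_of_nonneg_left hK1 ht0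
      have h3 : d * L ≤ t * K * L := by nlinarith
      exact le_of_mul_le_mul_right h3 hL0
    push_cast
    linarith
  have h2e : (2 : ℝ) ≤ Real.exp 1 := by linarith [Real.add_one_le_exp 1]
  have hsq : Real.sqrt d = Real.exp (L / 2) := by
    rw [hL, Real.sqrt_eq_rpow, Real.rpow_def_of_pos hd0]
    ring_nf
  calc _ ≤ Real.exp 1 ^ ((d - 1) / K + 1) *
        (Real.exp (L / 2) * (Real.exp 1 * Real.exp 1)) ^ K := by
        rw [hsq]
        gcongr
    _ = Real.exp (((d - 1) / K + 1 : ℕ) + K * (L / 2 + 2)) := by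
        rw [← Real.exp_nat_mul, ← Real.exp_add, ← Real.exp_add, ← Real.exp_nat_mul, ← Real.exp_add]
        ring_nf
    _ ≤ Real.exp (11 * t) := by
        refine Real.exp_le_exp.2 ?_
        linarith
    _ = _ := Real.exp_mul _ _

lemma abs_eval_le_supOnBox {n : ℕ} (P : MvPolynomial (Fin n) ℝ) {x : Fin n → ℝ}
    (hx : ∀ i, x i ∈ Set.Icc (-1 : ℝ) 1) : |MvPolynomial.eval x P| ≤ supOnBox P := by
  have hcont : Continuous fun x : Fin n → ℝ => |MvPolynomial.eval x P| :=
    (MvPolynomial.continuous_eval P).abs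
  have hcomp : IsCompact (Set.univ.pi fun _ : Fin n => Set.Icc (-1 : ℝ) 1) :=
    isCompact_univ_pi fun _ => isCompact_Icc
  obtain ⟨B, hB⟩ := hcomp.bddAbove_image hcont.continuousOn
  refine le_csSup ⟨B, ?_⟩ ⟨x, hx, rfl⟩
  rintro y ⟨x, hx, rfl⟩
  exact hB ⟨x, fun i _ => hx i, rfl⟩

/-- Bohnenblust–Hille type inequality on `[-1,1]^n` for real polynomials of degree at most `d`,
with constant `C^{√(d log d)} · d · (1+√2)^d`. -/
theorem bh_real_degree_d :
    ∃ C > (0 : ℝ), ∀ (d n : ℕ), 2 ≤ d → ∀ P : MvPolynomial (Fin n) ℝ,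
      P.totalDegree ≤ d →
      (∑ α ∈ P.support, |P.coeff α| ^ ((2 * d : ℝ) / (d + 1))) ^ ((d + 1 : ℝ) / (2 * d))
        ≤ C ^ Real.sqrt (d * Real.log d) * d * (1 + Real.sqrt 2) ^ d * supOnBox P := by
  refine ⟨Real.exp 11, Real.exp_pos _, fun d n hd P hP => ?_⟩
  obtain ⟨K, hK, hbound⟩ := exists_block_length_bound hd
  have hd1 : (1 : ℝ) ≤ d := by exact_mod_cast (by omega : 1 ≤ d)
  have hsup0 : 0 ≤ supOnBox P :=
    (abs_nonneg _).trans (abs_eval_le_supOnBox P (x := 0) fun i => by simp)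
  obtain ⟨M, hM⟩ : ∃ M, M = (1 + Real.sqrt 2) ^ d * supOnBox P := ⟨_, rfl⟩
  have hM0 : 0 ≤ M := hM ▸ by positivity
  have hdeg : ∀ α ∈ P.support, ∑ i, α i ≤ d := by
    intro α hα
    have := (MvPolynomial.le_totalDegree hα).trans hP
    rwa [Finsupp.sum_fintype _ _ fun _ => rfl] at this
  have hreal : ∀ x : Fin n → ℝ, (∀ i, x i ∈ Set.Icc (-1 : ℝ) 1) →
      |∑ α ∈ P.support, P.coeff α * ∏ i, x i ^ α i| ≤ supOnBox P := by
    intro x hx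
    rw [← MvPolynomial.eval_eq']
    exact abs_eval_le_supOnBox P hx
  have hinj : Set.InjOn (fun (α : Fin n →₀ ℕ) i => α i) P.support :=
    fun α _ β _ h => DFunLike.coe_injective h
  have hcoe : ∀ α : Fin n →₀ ℕ, Finsupp.equivFunOnFinite.symm (fun i => α i) = α := fun α => by
    ext
    simp
  have hmain := bohnenblust_hille_of_homogenization
    (P.support.image fun α i => α i) (fun t => P.coeff (Finsupp.equivFunOnFinite.symm t))
    (d := d) (M := M) (by omega) (by
      intro t ht
      obtain ⟨α, hα, rfl⟩ := mem_image.1 ht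
      exact hdeg α hα) (fun w z hw hz => by
      rw [sum_image hinj]
      simp only [hcoe]
      refine norm_homogenization_le P.support (fun α => ((P.coeff α : ℝ) : ℂ)) (fun α i => α i) hdeg
        (fun z hz => ?_) hw z hz
      rw [hM]
      exact norm_complexification_le P.support (fun α => P.coeff α) (fun α i => α i) hdeg hreal z hz) hK
  rw [sum_image hinj] at hmain
  simp only [hcoe] at hmain
  obtain ⟨X, hX⟩ : ∃ X, X = ∑ α ∈ P.support, |P.coeff α| ^ ((2 * d : ℝ) / (d + 1)) := ⟨_, rfl⟩
  obtain ⟨y, hy⟩ : ∃ y, y = (2 : ℝ) ^ ((d - 1) / K + 1) * (Real.sqrt d * (2 * Real.exp 1)) ^ K * M :=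
    ⟨_, rfl⟩
  have hX0 : 0 ≤ X := hX ▸ sum_nonneg fun _ _ => Real.rpow_nonneg (abs_nonneg _) _
  have hy0 : 0 ≤ y := hy ▸ by positivity
  rw [← hX, ← hy] at hmain
  rw [← hX]
  have hXy : X ^ ((d + 1 : ℝ) / (2 * d)) ≤ y := by
    have h2d : 2 * d ≠ 0 := by omega
    refine le_of_pow_le_pow_left₀ h2d hy0 (le_trans (le_of_eq ?_) hmain)
    rw [← Real.rpow_natCast, ← Real.rpow_mul hX0, ← Real.rpow_natCast X]
    congr 1
    push_cast
    field_simp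
  calc _ ≤ y := hXy
    _ ≤ Real.exp 11 ^ Real.sqrt (d * Real.log d) * M := by
        rw [hy]
        exact mul_le_mul_of_nonneg_right hbound hM0
    _ ≤ Real.exp 11 ^ Real.sqrt (d * Real.log d) * d * M :=
        mul_le_mul_of_nonneg_right (le_mul_of_one_le_right (by positivity) hd1) hM0
    _ = _ := by rw [hM, ← mul_assoc]
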